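/- arXiv:1904.00931 — 3 statements merged into one kernel-verified Lean document; each statement's English description precedes it below -/
import Mathlib

section
/- Under the framework assumptions on the structure of the system and on the data, with λ₁ = 0 and u − u_∞ ∈ L²(0,+∞;H) for some u_∞ ∈ H, suppose in addition that: D(β) is an open interval and β is a single-valued C¹ function on it; there exists a compact interval [a,b] ⊂ D(β) such that y(x,t) ∈ [a,b] for a.a. (x,t) ∈ Ω×(0,+∞); and V_B^σ ∩ L∞(Ω) is dense in V_B^σ. Then, for every y_ω in the ω-limit set, the function μ_∞ appearing in the characterization of y_ω is uniquely determined and constant; moreover y_ω ∈ V_B^{2σ} and the pair (y_ω, μ_∞) satisfies the strong stationary equation B^{2σ} y_ω + β(y_ω) + π(y_ω) = μ_∞ + u_∞ a.e. in Ω. -/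
noncomputable section

open MeasureTheory Filter Topology RealInnerProductSpace Set ENNReal NNReal

namespace FracCH

/-- The ambient space `ℝ³`. -/
abbrev E3 := EuclideanSpace ℝ (Fin 3)

/-- Lebesgue measure restricted to `Om`. -/
abbrev mOm (Om : Set E3) : Measure E3 := volume.restrict Om

/-- The Hilbert space `H = L²(Om)`. -/
abbrev Hs (Om : Set E3) := MeasureTheory.Lp ℝ 2 (mOm Om)

/-- The fractional power (in the spectral sense) with exponent `ρ` of the operator whose
eigenvalues are `lam` and whose orthonormal eigenvectors are `e`. -/
def fracPow {Om : Set E3} (lam : ℕ → ℝ) (e : ℕ → Hs Om) (ρ : ℝ) (v : Hs Om) : Hs Om :=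
  ∑' j, ((lam j) ^ ρ * ⟪v, e j⟫) • e j

/-- Membership in the domain of the fractional power of exponent `ρ`. -/
def inDom {Om : Set E3} (lam : ℕ → ℝ) (e : ℕ → Hs Om) (ρ : ℝ) (v : Hs Om) : Prop :=
  Summable fun j => ((lam j) ^ ρ * ⟪v, e j⟫) ^ 2

/-- Mean value of `v` on `Om`. -/
def meanVal {Om : Set E3} (v : Hs Om) : ℝ := (∫ x, v x ∂(mOm Om)) / (volume Om).toReal

/-- Subdifferential of a convex function `b : ℝ → [0,+∞]`. -/
def subdiff (b : ℝ → ℝ≥0∞) (s : ℝ) : Set ℝ :=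
  {ξ | b s < ⊤ ∧ ∀ t : ℝ, ENNReal.ofReal ((b s).toReal + ξ * (t - s)) ≤ b t}

/-- Square of the graph norm of the domain of a fractional power. -/
def gnormSq {Om : Set E3} (lam : ℕ → ℝ) (e : ℕ → Hs Om) (ρ : ℝ) (v : Hs Om) : ℝ :=
  ‖v‖ ^ 2 + ‖fracPow lam e ρ v‖ ^ 2

/-- Square of the dual norm (the norm of `V_A^{-r}`) of a linear functional. -/
def dualNormSq {Om : Set E3} (lam : ℕ → ℝ) (e : ℕ → Hs Om) (ρ : ℝ)
    (f : Hs Om →ₗ[ℝ] ℝ) : ℝ :=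
  sSup {a : ℝ | ∃ v : Hs Om, inDom lam e ρ v ∧ gnormSq lam e ρ v ≤ 1 ∧ a = (f v) ^ 2}

/-- The inner product of the Hilbert space which is the domain of a fractional power
(e.g.`V_B^σ`). -/
def innerFrac {Om : Set E3} (lam : ℕ → ℝ) (e : ℕ → Hs Om) (ρ : ℝ) (a b : Hs Om) : ℝ :=
  ⟪a, b⟫ + ⟪fracPow lam e ρ a, fracPow lam e ρ b⟫

/-- The structural assumptions: `Om ⊂ ℝ³` is open, connected and bounded; `A` and `B` are
unbounded monotone selfadjoint operators with compact resolvents, described by their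
nondecreasing sequences of eigenvalues `lamA`, `lamB` (tending to `+∞`) and complete
orthonormal systems of eigenvectors `eA`, `eB`; `r, σ > 0`, `τ ∈ [0,1]`; either `λ₁ > 0`
or `0 = λ₁ < λ₂` with `e₁` constant; if `λ₁ = 0` the constants belong to `V_B^σ`. -/
def SettingHyps (Om : Set E3) (lamA lamB : ℕ → ℝ) (eA eB : ℕ → Hs Om)
    (r σ τ : ℝ) : Prop :=
  IsOpen Om ∧ IsConnected Om ∧ Bornology.IsBounded Om ∧
  (∀ j, 0 ≤ lamA j) ∧ (∀ j, 0 ≤ lamB j) ∧ Monotone lamA ∧ Monotone lamB ∧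
  Tendsto lamA atTop atTop ∧ Tendsto lamB atTop atTop ∧
  Orthonormal ℝ eA ∧ Orthonormal ℝ eB ∧
  (Submodule.span ℝ (Set.range eA)).topologicalClosure = ⊤ ∧
  (Submodule.span ℝ (Set.range eB)).topologicalClosure = ⊤ ∧
  0 < r ∧ 0 < σ ∧ τ ∈ Set.Icc (0:ℝ) 1 ∧
  (0 < lamA 0 ∨ (lamA 0 = 0 ∧ 0 < lamA 1 ∧ ∃ c : ℝ, ∀ᵐ x ∂(mOm Om), eA 0 x = c)) ∧
  (lamA 0 = 0 → ∀ c : ℝ, ∃ w : Hs Om, inDom lamB eB σ w ∧ (∀ᵐ x ∂(mOm Om), w x = c))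

/-- The assumptions on the nonlinearity `f = β̂ + π̂` and on the data `u`, `y₀`:
`β̂ : ℝ → [0,+∞]` is convex, l.s.c., with `β̂(0) = 0`; `π̂` is `C¹` with Lipschitz
continuous derivative `π`; the coercivity `liminf_{|s|→∞}(β̂(s)+π̂(s))/s² > 0` holds;
`u ∈ W^{1,1}_loc([0,∞);H)` with primitive representation by `u'` and `∂_t u ∈ L¹(0,∞;H)`;
`y₀ ∈ V_B^σ` with `β̂(y₀) ∈ L¹(Om)`; and if `λ₁ = 0` the mean of `y₀` lies in the
interior of `D(β)`. -/
def DataHyps (Om : Set E3) (lamA lamB : ℕ → ℝ) (eB : ℕ → Hs Om) (σ : ℝ)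
    (betah : ℝ → ℝ≥0∞) (pih piF : ℝ → ℝ) (Lpi : ℝ≥0)
    (u u' : ℝ → Hs Om) (y0 : Hs Om) : Prop :=
  (∀ a b t : ℝ, 0 ≤ t → t ≤ 1 →
    betah (t * a + (1 - t) * b) ≤ ENNReal.ofReal t * betah a + ENNReal.ofReal (1 - t) * betah b) ∧
  LowerSemicontinuous betah ∧ betah 0 = 0 ∧
  (∀ s, HasDerivAt pih (piF s) s) ∧ LipschitzWith Lpi piF ∧
  (∃ α : ℝ, 0 < α ∧ ∀ᶠ s : ℝ in Filter.comap (|·|) atTop,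
    ENNReal.ofReal (α * s ^ 2 - pih s) ≤ betah s) ∧
  IntegrableOn u' (Set.Ioi (0:ℝ)) ∧
  (∀ t : ℝ, 0 ≤ t → u t = u 0 + ∫ s in (0:ℝ)..t, u' s) ∧
  inDom lamB eB σ y0 ∧ (∫⁻ x, betah (y0 x) ∂(mOm Om)) < ⊤ ∧
  (lamA 0 = 0 → meanVal y0 ∈ interior {s : ℝ | (subdiff betah s).Nonempty})

/-- The notion of solution `(y, μ)` of the weak formulation of the fractional
Cahn--Hilliard system on the half line `t ≥ 0`.  Here `dy t ∈ V_A^{-r}` represents the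
time derivative `∂_t y(t)` (acting on test functions, and linked to `y` by the integral
identity `(y(t),v) = (y(0),v) + ∫_0^t ⟨∂_t y(s),v⟩ ds`), while `z` represents
`τ ∂_t y ∈ L²(0,T;H)`.  The requirements are the regularity
`y ∈ L^∞(0,T;V_B^σ)`, `∂_t y ∈ L²(0,T;V_A^{-r})`, `τ ∂_t y ∈ L²(0,T;H)`,
`μ ∈ L²(0,T;V_A^r)`, `β̂(y) ∈ L¹(Om×(0,T))` for every `T > 0`, the two variational
equations/inequalities for a.a. `t`, and the initial condition `y(0) = y₀`. -/
def IsSolution (Om : Set E3) (lamA lamB : ℕ → ℝ) (eA eB : ℕ → Hs Om) (r σ τ : ℝ)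
    (betah : ℝ → ℝ≥0∞) (piF : ℝ → ℝ) (u : ℝ → Hs Om) (y0 : Hs Om)
    (y μ : ℝ → Hs Om) (dy : ℝ → Hs Om →ₗ[ℝ] ℝ) (z : ℝ → Hs Om) : Prop :=
  AEStronglyMeasurable y (volume.restrict (Set.Ioi (0:ℝ))) ∧
  (∀ᵐ t ∂(volume.restrict (Set.Ioi (0:ℝ))), inDom lamB eB σ (y t)) ∧
  (∀ T : ℝ, 0 < T → ∃ C : ℝ,
    ∀ᵐ t ∂(volume.restrict (Set.Ioc (0:ℝ) T)), gnormSq lamB eB σ (y t) ≤ C) ∧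
  (∀ v : Hs Om, inDom lamA eA r v → ∀ T : ℝ, 0 < T →
    IntegrableOn (fun s => dy s v) (Set.Ioc (0:ℝ) T)) ∧
  (∀ v : Hs Om, inDom lamA eA r v → ∀ t : ℝ, 0 ≤ t →
    ⟪y t, v⟫ = ⟪y 0, v⟫ + ∫ s in (0:ℝ)..t, dy s v) ∧
  (∀ T : ℝ, 0 < T → IntegrableOn (fun t => dualNormSq lamA eA r (dy t)) (Set.Ioc (0:ℝ) T)) ∧
  AEStronglyMeasurable z (volume.restrict (Set.Ioi (0:ℝ))) ∧
  (∀ᵐ t ∂(volume.restrict (Set.Ioi (0:ℝ))), ∀ v : Hs Om, inDom lamA eA r v →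
    ⟪z t, v⟫ = τ * dy t v) ∧
  (∀ T : ℝ, 0 < T → IntegrableOn (fun t => ‖z t‖ ^ 2) (Set.Ioc (0:ℝ) T)) ∧
  AEStronglyMeasurable μ (volume.restrict (Set.Ioi (0:ℝ))) ∧
  (∀ᵐ t ∂(volume.restrict (Set.Ioi (0:ℝ))), inDom lamA eA r (μ t)) ∧
  (∀ T : ℝ, 0 < T → IntegrableOn (fun t => gnormSq lamA eA r (μ t)) (Set.Ioc (0:ℝ) T)) ∧
  (∀ T : ℝ, 0 < T → (∫⁻ t in Set.Ioc (0:ℝ) T, ∫⁻ x, betah (y t x) ∂(mOm Om)) < ⊤) ∧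
  (∀ᵐ t ∂(volume.restrict (Set.Ioi (0:ℝ))), ∀ v : Hs Om, inDom lamA eA r v →
    dy t v + ⟪fracPow lamA eA r (μ t), fracPow lamA eA r v⟫ = 0) ∧
  (∀ᵐ t ∂(volume.restrict (Set.Ioi (0:ℝ))), ∀ v : Hs Om,
    inDom lamB eB σ v → (∫⁻ x, betah (v x) ∂(mOm Om)) < ⊤ →
    ⟪z t, y t - v⟫
      + ⟪fracPow lamB eB σ (y t), fracPow lamB eB σ (y t) - fracPow lamB eB σ v⟫
      + (∫⁻ x, betah (y t x) ∂(mOm Om)).toReal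
      + ∫ x, (piF (y t x) - u t x) * (y t x - v x) ∂(mOm Om)
      ≤ ⟪μ t, y t - v⟫ + (∫⁻ x, betah (v x) ∂(mOm Om)).toReal) ∧
  y 0 = y0

/-- The ω-limit set of the trajectory `y`, in the weak topology of `V_B^σ`. -/
def omegaLimit {Om : Set E3} (lamB : ℕ → ℝ) (eB : ℕ → Hs Om) (σ : ℝ)
    (y : ℝ → Hs Om) : Set (Hs Om) :=
  {w | inDom lamB eB σ w ∧ ∃ tn : ℕ → ℝ, StrictMono tn ∧ (∀ n, 0 ≤ tn n) ∧
    Tendsto tn atTop atTop ∧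
    ∀ φ : Hs Om, inDom lamB eB σ φ →
      Tendsto (fun n => innerFrac lamB eB σ (y (tn n)) φ) atTop
        (nhds (innerFrac lamB eB σ w φ))}

section EnergyBound

variable {V : Type*} [NormedAddCommGroup V] [InnerProductSpace ℝ V]

lemma norm_integral_sq_le {X : ℝ → V} {s t : ℝ} (hst : s ≤ t)
    (hX : IntervalIntegrable X volume s t)
    (hX2 : IntervalIntegrable (fun r => ‖X r‖ ^ 2) volume s t) :
    ‖∫ r in s..t, X r‖ ^ 2 ≤ (t - s) * ∫ r in s..t, ‖X r‖ ^ 2 := by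
  rcases hst.eq_or_lt with rfl | hlt
  · simp
  set I := ∫ r in s..t, ‖X r‖ with hI
  set J := ∫ r in s..t, ‖X r‖ ^ 2 with hJ
  have h0 : 0 ≤ ∫ r in s..t, ((t - s) * ‖X r‖ - I) ^ 2 :=
    intervalIntegral.integral_nonneg hst fun r _ => sq_nonneg _
  have h1 : ∫ r in s..t, ((t - s) * ‖X r‖ - I) ^ 2
      = (t - s) ^ 2 * J - 2 * (t - s) * I * I + (t - s) * I ^ 2 := by
    have : (fun r => ((t - s) * ‖X r‖ - I) ^ 2)
        = fun r => ((t - s) ^ 2 * ‖X r‖ ^ 2 - 2 * (t - s) * I * ‖X r‖) + I ^ 2 := by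
      ext r; ring
    rw [this, intervalIntegral.integral_add, intervalIntegral.integral_sub,
      intervalIntegral.integral_const_mul, intervalIntegral.integral_const_mul,
      intervalIntegral.integral_const, smul_eq_mul]
    · exact hX2.const_mul _
    · exact hX.norm.const_mul _
    · exact (hX2.const_mul _).sub (hX.norm.const_mul _)
    · exact intervalIntegrable_const
  have h2 : 0 ≤ (t - s) * ((t - s) * J - I ^ 2) := by
    rw [h1] at h0; nlinarith
  have h3 : I ^ 2 ≤ (t - s) * J := by
    have := nonneg_of_mul_nonneg_right h2 (sub_pos.2 hlt)
    linarith
  have h4 : ‖∫ r in s..t, X r‖ ≤ I := intervalIntegral.norm_integral_le_integral_norm hst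
  exact (pow_le_pow_left₀ (norm_nonneg _) h4 2).trans h3

lemma integral_sub_shift {G : ℝ → ℝ} (hG : ∀ a b, IntervalIntegrable G volume a b) (S T h : ℝ) :
    ∫ t in S..T, (G t - G (t - h)) = (∫ t in (T - h)..T, G t) - ∫ t in (S - h)..S, G t := by
  rw [intervalIntegral.integral_sub (hG _ _), intervalIntegral.integral_comp_sub_right]
  · have h1 := intervalIntegral.integral_add_adjacent_intervals (hG (S - h) S) (hG S T)
    have h2 := intervalIntegral.integral_add_adjacent_intervals (hG (S - h) (T - h)) (hG (T - h) T)
    linarith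
  · simpa using (hG (S - h) (T - h)).comp_sub_right h

lemma ae_shift {p : ℝ → Prop} (hp : ∀ᵐ t, p t) (h : ℝ) : ∀ᵐ t, p (t - h) :=
  (measurePreserving_sub_right (volume : Measure ℝ) h).quasiMeasurePreserving.ae hp

lemma intervalIntegrable_inner_increment {X : ℝ → V}
    (hX : ∀ a b, IntervalIntegrable X volume a b) {S T : ℝ} (h : ℝ) :
    IntervalIntegrable (fun t => ⟪X t, ∫ r in (t - h)..t, X r⟫) volume S T := by
  have hc : Continuous fun t => ∫ r in (t - h)..t, X r := by
    have h1 : Continuous fun t => ∫ r in (0:ℝ)..t, X r :=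
      intervalIntegral.continuous_primitive hX 0
    have h2 : (fun t => ∫ r in (t - h)..t, X r)
        = fun t => (∫ r in (0:ℝ)..t, X r) - ∫ r in (0:ℝ)..(t - h), X r := by
      ext t
      rw [intervalIntegral.integral_interval_sub_left (hX _ _) (hX _ _)]
    rw [h2]
    exact h1.sub (h1.comp (continuous_id.sub continuous_const))
  obtain ⟨M, hM⟩ := (isCompact_uIcc (a := S) (b := T)).exists_bound_of_continuousOn hc.continuousOn
  refine IntervalIntegrable.mono_fun' (g := fun t => ‖X t‖ * M) ((hX S T).norm.mul_const M) ?_ ?_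
  · exact (intervalIntegrable_iff.1 (hX S T)).aestronglyMeasurable.inner hc.aestronglyMeasurable
  · filter_upwards [ae_restrict_mem measurableSet_uIoc] with t ht
    exact (norm_inner_le_norm _ _).trans
      (mul_le_mul_of_nonneg_left (hM t (uIoc_subset_uIcc ht)) (norm_nonneg _))

/-- Averaging a discrete energy inequality over all times. -/
lemma integral_inner_average_le {X : ℝ → V} {E : ℝ → ℝ} {P : ℝ → Prop} {K C1 C : ℝ}
    (hX : ∀ a b, IntervalIntegrable X volume a b)
    (hX2 : ∀ a b, IntervalIntegrable (fun r => ‖X r‖ ^ 2) volume a b)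
    (hE : ∀ a b, IntervalIntegrable E volume a b)
    (hlow : ∀ᵐ t, 0 < t → -K ≤ E t)
    (hup : ∀ᵐ t, 0 < t → t ≤ 1 → E t ≤ C1)
    (hP : ∀ᵐ t, 0 < t → P t) (hC : 0 ≤ C)
    (hineq : ∀ s t, 0 < s → s < t → P s → P t →
      E t - E s ≤ -⟪X t, ∫ r in s..t, X r⟫ + C * ‖∫ r in s..t, X r‖ ^ 2)
    {T h : ℝ} (hT : 1 ≤ T) (h0 : 0 < h) (h1 : h < 1) :
    ∫ t in (1:ℝ)..T, ⟪X t, h⁻¹ • ∫ r in (t - h)..t, X r⟫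
      ≤ K + C1 + h * (C * ∫ r in (0:ℝ)..T, ‖X r‖ ^ 2) := by
  set G : ℝ → ℝ := fun t => ∫ r in (0:ℝ)..t, ‖X r‖ ^ 2 with hGdef
  have hGc : Continuous G := intervalIntegral.continuous_primitive hX2 0
  have hGi : ∀ a b, IntervalIntegrable G volume a b := fun a b => hGc.intervalIntegrable a b
  have hGsub : ∀ s t, G t - G s = ∫ r in s..t, ‖X r‖ ^ 2 := fun s t =>
    intervalIntegral.integral_interval_sub_left (hX2 _ _) (hX2 _ _)
  have hGmono : Monotone G := fun s t hst => by
    have : 0 ≤ G t - G s := by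
      rw [hGsub]; exact intervalIntegral.integral_nonneg hst fun _ _ => sq_nonneg _
    linarith
  have hG0 : G 0 = 0 := by simp [hGdef]
  have hI := intervalIntegrable_inner_increment hX (S := 1) (T := T) h
  have hIn : IntervalIntegrable (fun t => -⟪X t, ∫ r in (t - h)..t, X r⟫) volume 1 T := hI.neg
  have hEsh : IntervalIntegrable (fun t => E (t - h)) volume 1 T := by
    simpa using (hE (1 - h) (T - h)).comp_sub_right h
  have hGsh : IntervalIntegrable (fun t => G (t - h)) volume 1 T := by
    simpa using (hGi (1 - h) (T - h)).comp_sub_right h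
  have hmain : ∫ t in (1:ℝ)..T, (E t - E (t - h))
      ≤ ∫ t in (1:ℝ)..T, (-⟪X t, ∫ r in (t - h)..t, X r⟫ + (C * h) * (G t - G (t - h))) := by
    refine intervalIntegral.integral_mono_ae_restrict hT ((hE _ _).sub hEsh)
      (hIn.add (((hGi _ _).sub hGsh).const_mul _)) ?_
    filter_upwards [ae_restrict_of_ae hP, ae_restrict_of_ae (ae_shift hP h),
      ae_restrict_mem measurableSet_Icc] with t ht1 ht2 ht
    have hs : 0 < t - h := by linarith [ht.1]
    have := hineq (t - h) t hs (by linarith) (ht2 hs) (ht1 (by linarith [ht.1]))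
    refine this.trans ?_
    have hn := norm_integral_sq_le (X := X) (s := t - h) (t := t) (by linarith) (hX _ _) (hX2 _ _)
    rw [hGsub]
    rw [_root_.sub_sub_cancel] at hn
    have := mul_le_mul_of_nonneg_left hn hC
    nlinarith
  rw [integral_sub_shift hE, intervalIntegral.integral_add hIn
    (((hGi _ _).sub hGsh).const_mul _), intervalIntegral.integral_const_mul,
    intervalIntegral.integral_neg, integral_sub_shift hGi] at hmain
  have e1 : -K * h ≤ ∫ t in (T - h)..T, E t := by
    have : ∫ t in (T - h)..T, (-K) ≤ ∫ t in (T - h)..T, E t := by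
      refine intervalIntegral.integral_mono_ae_restrict (by linarith) intervalIntegrable_const
        (hE _ _) ?_
      filter_upwards [ae_restrict_of_ae hlow, ae_restrict_mem measurableSet_Icc] with t h2 ht
      exact h2 (by linarith [ht.1])
    rw [intervalIntegral.integral_const, smul_eq_mul] at this
    linarith
  have e2 : ∫ t in (1 - h)..1, E t ≤ C1 * h := by
    have : ∫ t in (1 - h)..1, E t ≤ ∫ t in (1 - h)..1, C1 := by
      refine intervalIntegral.integral_mono_ae_restrict (by linarith) (hE _ _)
        intervalIntegrable_const ?_
      filter_upwards [ae_restrict_of_ae hup, ae_restrict_mem measurableSet_Icc] with t h2 ht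
      exact h2 (by linarith [ht.1]) ht.2
    rw [intervalIntegral.integral_const, smul_eq_mul] at this
    linarith
  have e3 : ∫ t in (T - h)..T, G t ≤ h * G T := by
    have : ∫ t in (T - h)..T, G t ≤ ∫ t in (T - h)..T, G T :=
      intervalIntegral.integral_mono_on (by linarith) (hGi _ _)
        intervalIntegrable_const fun t ht => hGmono ht.2
    rw [intervalIntegral.integral_const, smul_eq_mul] at this
    linarith
  have e4 : 0 ≤ ∫ t in (1 - h)..1, G t :=
    intervalIntegral.integral_nonneg (by linarith) fun t ht => by
      rw [← hG0]; exact hGmono (by linarith [ht.1])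
  have e5 : C * h * ((∫ t in (T - h)..T, G t) - ∫ t in (1 - h)..1, G t) ≤ C * h * (h * G T) :=
    mul_le_mul_of_nonneg_left (by linarith) (by positivity)
  simp_rw [inner_smul_right]
  rw [intervalIntegral.integral_const_mul, inv_mul_le_iff₀ h0]
  have : h * (K + C1 + h * (C * G T)) = h * K + h * C1 + C * h * (h * G T) := by ring
  rw [this]
  linarith

lemma tendsto_average_left {W : Type*} [NormedAddCommGroup W] [NormedSpace ℝ W] [CompleteSpace W]
    {X : ℝ → W} (hX : ∀ a b, IntervalIntegrable X volume a b) {h : ℕ → ℝ}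
    (hpos : ∀ n, 0 < h n) (hlim : Tendsto h atTop (𝓝 0)) :
    ∀ᵐ t, Tendsto (fun n => (h n)⁻¹ • ∫ r in (t - h n)..t, X r) atTop (𝓝 (X t)) := by
  have hloc : LocallyIntegrable X volume := by
    rw [locallyIntegrable_iff]
    intro k hk
    obtain ⟨R, hR⟩ := hk.isBounded.subset_closedBall 0
    rw [Real.closedBall_eq_Icc] at hR
    refine IntegrableOn.mono_set ?_ hR
    rcases le_total (0 - R) (0 + R) with hle | hle
    · exact (intervalIntegrable_iff_integrableOn_Icc_of_le hle).1 (hX _ _)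
    · rcases hle.eq_or_lt with h | h
      · rw [h]; simp
      · rw [Icc_eq_empty (not_le.2 h)]; simp
  filter_upwards [_root_.LocallyIntegrable.ae_hasDerivAt_integral hloc] with t ht
  have h1 := (ht 0).tendsto_slope
  have h2 : Tendsto (fun n => t - h n) atTop (𝓝[≠] t) := by
    refine tendsto_nhdsWithin_iff.2 ⟨?_, Eventually.of_forall fun n => ?_⟩
    · simpa using tendsto_const_nhds.sub hlim
    · have := hpos n
      simp only [mem_compl_iff, mem_singleton_iff]; intro hh; linarith
  refine (h1.comp h2).congr fun n => ?_
  simp only [Function.comp, slope, vsub_eq_sub]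
  rw [intervalIntegral.integral_interval_sub_left (hX _ _) (hX _ _),
    intervalIntegral.integral_symm (t - h n) t, show t - h n - t = -(h n) by ring, inv_neg]
  simp

variable [CompleteSpace V] in
/-- A discrete energy inequality yields a global `L²` bound on the dissipation. -/
lemma integral_norm_sq_le_of_energy {X : ℝ → V} {E : ℝ → ℝ} {P : ℝ → Prop} {K C1 C : ℝ}
    (hX : ∀ a b, IntervalIntegrable X volume a b)
    (hX2 : ∀ a b, IntervalIntegrable (fun r => ‖X r‖ ^ 2) volume a b)
    (hE : ∀ a b, IntervalIntegrable E volume a b)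
    (hlow : ∀ᵐ t, 0 < t → -K ≤ E t)
    (hup : ∀ᵐ t, 0 < t → t ≤ 1 → E t ≤ C1)
    (hP : ∀ᵐ t, 0 < t → P t) (hC : 0 ≤ C)
    (hineq : ∀ s t, 0 < s → s < t → P s → P t →
      E t - E s ≤ -⟪X t, ∫ r in s..t, X r⟫ + C * ‖∫ r in s..t, X r‖ ^ 2)
    {T : ℝ} (hT : 1 ≤ T) :
    ∫ t in (1:ℝ)..T, ‖X t‖ ^ 2 ≤ K + C1 := by
  set h : ℕ → ℝ := fun n => 1 / ((n : ℝ) + 2) with hh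
  have hpos : ∀ n, 0 < h n := fun n => by positivity
  have hlt : ∀ n, h n < 1 := fun n => by
    rw [hh]; simp only; rw [div_lt_one (by positivity)]; linarith [n.cast_nonneg (α := ℝ)]
  have hlim : Tendsto h atTop (𝓝 0) :=
    tendsto_const_nhds.div_atTop (tendsto_atTop_add_const_right _ _ tendsto_natCast_atTop_atTop)
  set G : ℝ → ℝ := fun t => ∫ r in (0:ℝ)..t, ‖X r‖ ^ 2 with hGdef
  have hGc : Continuous G := intervalIntegral.continuous_primitive hX2 0
  have hGi : ∀ a b, IntervalIntegrable G volume a b := fun a b => hGc.intervalIntegrable a b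
  have hGsub : ∀ s t, G t - G s = ∫ r in s..t, ‖X r‖ ^ 2 := fun s t =>
    intervalIntegral.integral_interval_sub_left (hX2 _ _) (hX2 _ _)
  have hGmono : Monotone G := fun s t hst => by
    have : 0 ≤ G t - G s := by
      rw [hGsub]; exact intervalIntegral.integral_nonneg hst fun _ _ => sq_nonneg _
    linarith
  set f : ℕ → ℝ → ℝ := fun n t => ⟪X t, (h n)⁻¹ • ∫ r in (t - h n)..t, X r⟫ + ‖X t‖ ^ 2 / 2
    + (h n)⁻¹ * (G t - G (t - h n)) / 2 with hf
  have hGsh : ∀ n, IntervalIntegrable (fun t => G (t - h n)) volume 1 T := fun n => by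
    simpa using (hGi (1 - h n) (T - h n)).comp_sub_right (h n)
  have hfI1 : ∀ n, IntervalIntegrable (fun t => ⟪X t, (h n)⁻¹ • ∫ r in (t - h n)..t, X r⟫)
      volume 1 T := fun n => by
    simp_rw [inner_smul_right]
    exact (intervalIntegrable_inner_increment hX (h n)).const_mul _
  have hfI3 : ∀ n, IntervalIntegrable (fun t => (h n)⁻¹ * (G t - G (t - h n)) / 2)
      volume 1 T := fun n => (((hGi _ _).sub (hGsh n)).const_mul _).div_const _
  have hfI : ∀ n, IntervalIntegrable (f n) volume 1 T := fun n =>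
    ((hfI1 n).add ((hX2 _ _).div_const _)).add (hfI3 n)
  have hf0 : ∀ n t, 0 ≤ f n t := by
    intro n t
    have hn := norm_integral_sq_le (X := X) (s := t - h n) (t := t) (by linarith [hpos n])
      (hX _ _) (hX2 _ _)
    rw [_root_.sub_sub_cancel, ← hGsub] at hn
    set D := ∫ r in (t - h n)..t, X r
    have h1 : ‖(h n)⁻¹ • D‖ ^ 2 ≤ (h n)⁻¹ * (G t - G (t - h n)) := by
      rw [norm_smul, mul_pow, Real.norm_of_nonneg (inv_nonneg.2 (hpos n).le)]
      calc (h n)⁻¹ ^ 2 * ‖D‖ ^ 2 ≤ (h n)⁻¹ ^ 2 * (h n * (G t - G (t - h n))) := by gcongr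
        _ = (h n)⁻¹ * (G t - G (t - h n)) := by field_simp [(hpos n).ne']
    have h2 := norm_add_sq_real (X t) ((h n)⁻¹ • D)
    have h3 := sq_nonneg ‖X t + (h n)⁻¹ • D‖
    simp only [hf]
    linarith
  have hflim : ∀ᵐ t, Tendsto (fun n => f n t) atTop (𝓝 (2 * ‖X t‖ ^ 2)) := by
    filter_upwards [tendsto_average_left hX hpos hlim, tendsto_average_left hX2 hpos hlim]
      with t h1 h2
    have h3 := ((tendsto_const_nhds (x := X t)).inner h1).add_const (‖X t‖ ^ 2 / 2)
    have h4 := h3.add (h2.div_const 2)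
    simp only [hf]
    rw [real_inner_self_eq_norm_sq, show ‖X t‖ ^ 2 + ‖X t‖ ^ 2 / 2 + ‖X t‖ ^ 2 / 2 = 2 * ‖X t‖ ^ 2
      by ring] at h4
    refine h4.congr fun n => ?_
    rw [hGsub, smul_eq_mul]
  have hup2 : ∀ n, ∫ t in (1:ℝ)..T, f n t
      ≤ K + C1 + h n * (C * G T) + (G T - G 1) / 2 + (G T - G (1 - h n)) / 2 := by
    intro n
    have e0 : ∫ t in (1:ℝ)..T, (G t - G (t - h n)) ≤ h n * (G T - G (1 - h n)) := by
      rw [integral_sub_shift hGi]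
      have e3 : ∫ t in (T - h n)..T, G t ≤ ∫ t in (T - h n)..T, G T :=
        intervalIntegral.integral_mono_on (by linarith [hpos n]) (hGi _ _)
          intervalIntegrable_const fun t ht => hGmono ht.2
      have e4 : ∫ t in (1 - h n)..1, G (1 - h n) ≤ ∫ t in (1 - h n)..1, G t :=
        intervalIntegral.integral_mono_on (by linarith [hpos n]) intervalIntegrable_const
          (hGi _ _) fun t ht => hGmono ht.1
      rw [intervalIntegral.integral_const, smul_eq_mul] at e3 e4
      linarith
    have e1 : (h n)⁻¹ * ∫ t in (1:ℝ)..T, (G t - G (t - h n)) ≤ G T - G (1 - h n) := by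
      rw [inv_mul_le_iff₀ (hpos n)]; exact e0
    have e2 := integral_inner_average_le hX hX2 hE hlow hup hP hC hineq hT (hpos n) (hlt n)
    have e3 : ∫ t in (1:ℝ)..T, f n t = (∫ t in (1:ℝ)..T, ⟪X t, (h n)⁻¹ • ∫ r in (t - h n)..t, X r⟫)
        + (∫ t in (1:ℝ)..T, ‖X t‖ ^ 2) / 2
        + ((h n)⁻¹ * ∫ t in (1:ℝ)..T, (G t - G (t - h n))) / 2 := by
      simp only [hf]
      rw [intervalIntegral.integral_add ((hfI1 n).add ((hX2 _ _).div_const _)) (hfI3 n),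
        intervalIntegral.integral_add (hfI1 n) ((hX2 _ _).div_const _),
        intervalIntegral.integral_div, intervalIntegral.integral_div,
        intervalIntegral.integral_const_mul]
    rw [e3, ← hGsub]
    linarith
  have hfat : ∫⁻ t in Ioc 1 T, ENNReal.ofReal (2 * ‖X t‖ ^ 2)
      ≤ liminf (fun n => ∫⁻ t in Ioc 1 T, ENNReal.ofReal (f n t)) atTop := by
    refine le_trans (le_of_eq ?_) (lintegral_liminf_le' fun n =>
      (((intervalIntegrable_iff_integrableOn_Ioc_of_le hT).1
        (hfI n)).aestronglyMeasurable.aemeasurable.ennreal_ofReal))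
    refine lintegral_congr_ae ?_
    filter_upwards [ae_restrict_of_ae hflim] with t ht
    exact ((ENNReal.continuous_ofReal.tendsto _).comp ht).liminf_eq.symm
  have hlhs : ∫⁻ t in Ioc 1 T, ENNReal.ofReal (2 * ‖X t‖ ^ 2)
      = ENNReal.ofReal (2 * (G T - G 1)) := by
    rw [← ofReal_integral_eq_lintegral_ofReal, ← intervalIntegral.integral_of_le hT,
      intervalIntegral.integral_const_mul, hGsub]
    · exact (intervalIntegrable_iff_integrableOn_Ioc_of_le hT).1 ((hX2 1 T).const_mul 2)
    · exact Eventually.of_forall fun t => by positivity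
  have hrhs : Tendsto (fun n => ENNReal.ofReal
      (K + C1 + h n * (C * G T) + (G T - G 1) / 2 + (G T - G (1 - h n)) / 2)) atTop
      (𝓝 (ENNReal.ofReal (K + C1 + (G T - G 1)))) := by
    refine (ENNReal.continuous_ofReal.tendsto _).comp ?_
    have hG1 : Tendsto (fun n => G (1 - h n)) atTop (𝓝 (G 1)) :=
      (hGc.tendsto 1).comp (by simpa using tendsto_const_nhds.sub hlim)
    have := (((hlim.mul_const (C * G T)).const_add (K + C1)).add_const ((G T - G 1) / 2)).add
      ((hG1.const_sub (G T)).div_const 2)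
    convert this using 2
    ring
  rw [hlhs] at hfat
  have hfin : ENNReal.ofReal (2 * (G T - G 1)) ≤ ENNReal.ofReal (K + C1 + (G T - G 1)) := by
    refine hfat.trans ?_
    rw [← hrhs.liminf_eq]
    refine liminf_le_liminf (Eventually.of_forall fun n => ?_)
    rw [← ofReal_integral_eq_lintegral_ofReal, ← intervalIntegral.integral_of_le hT]
    · exact ENNReal.ofReal_le_ofReal (hup2 n)
    · exact (intervalIntegrable_iff_integrableOn_Ioc_of_le hT).1 (hfI n)
    · exact Eventually.of_forall fun t => hf0 n t
  have hGG : 0 ≤ G T - G 1 := sub_nonneg.2 (hGmono hT)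
  rw [← hGsub]
  rcases hGG.eq_or_lt with h0 | h0
  · rw [← h0]
    obtain ⟨t, h1, h2, h3, h4⟩ : ∃ t : ℝ, 0 < t ∧ t ≤ 1 ∧ -K ≤ E t ∧ E t ≤ C1 := by
      have hne : (volume.restrict (Ioc (0:ℝ) 1)) ≠ 0 := by
        rw [Ne, Measure.restrict_eq_zero]; simp
      have : NeBot (ae (volume.restrict (Ioc (0:ℝ) 1))) := ae_neBot.2 hne
      have hev : ∀ᵐ t ∂(volume.restrict (Ioc (0:ℝ) 1)),
          0 < t ∧ t ≤ 1 ∧ -K ≤ E t ∧ E t ≤ C1 := by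
        filter_upwards [ae_restrict_of_ae hlow, ae_restrict_of_ae hup,
          ae_restrict_mem measurableSet_Ioc] with t a b c
        exact ⟨c.1, c.2, a c.1, b c.1 c.2⟩
      exact hev.exists
    linarith
  · have := (ENNReal.ofReal_le_ofReal_iff' ).1 hfin
    rcases this with h | h
    · linarith
    · linarith

end EnergyBound

section Spectral

variable {Om : Set E3} {lam : ℕ → ℝ} {ρ : ℝ} (b : HilbertBasis ℕ ℝ (Hs Om))

lemma hasSum_inner_sq (v : Hs Om) : HasSum (fun j => ⟪v, b j⟫ ^ 2) (‖v‖ ^ 2) := by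
  have := b.hasSum_inner_mul_inner v v
  rw [real_inner_self_eq_norm_sq] at this
  refine this.congr_fun fun j => ?_
  rw [real_inner_comm v (b j), sq]

lemma ext_inner_basis {x y : Hs Om} (h : ∀ j, ⟪x, b j⟫ = ⟪y, b j⟫) : x = y := by
  have h1 := hasSum_inner_sq b (x - y)
  simp only [inner_sub_left, h, sub_self] at h1
  have h2 := h1.unique ((hasSum_zero (α := ℝ) (β := ℕ)).congr_fun fun j => by simp)
  rw [sq_eq_zero_iff, norm_eq_zero, sub_eq_zero] at h2
  exact h2

lemma inner_basis (i j : ℕ) : ⟪b i, b j⟫ = if i = j then (1:ℝ) else 0 :=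
  (orthonormal_iff_ite.1 b.orthonormal) i j

lemma exists_hasSum_smul_basis {c : ℕ → ℝ} (hc : Summable fun j => c j ^ 2) :
    ∃ x : Hs Om, HasSum (fun j => c j • b j) x := by
  have hm : Memℓp (fun j => c j) 2 := by
    refine memℓp_gen ?_
    simpa using hc
  exact ⟨_, b.hasSum_repr_symm ⟨c, hm⟩⟩

lemma inner_of_hasSum {c : ℕ → ℝ} {x : Hs Om} (h : HasSum (fun j => c j • b j) x) (j : ℕ) :
    ⟪x, b j⟫ = c j := by
  have h1 : HasSum (fun i => ⟪c i • b i, b j⟫) ⟪x, b j⟫ := by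
    have := (innerSL ℝ (b j)).hasSum h
    simp only [innerSL_apply_apply] at this
    rw [real_inner_comm]
    refine this.congr_fun fun i => ?_
    rw [real_inner_comm]
  refine h1.unique ?_
  convert hasSum_ite_eq j (c j) using 2 with i
  rw [inner_smul_left, inner_basis]
  by_cases hij : i = j <;> simp [hij]

variable {b}

lemma inner_fracPow {v : Hs Om} (h : inDom lam b ρ v) (j : ℕ) :
    ⟪fracPow lam b ρ v, b j⟫ = lam j ^ ρ * ⟪v, b j⟫ := by
  obtain ⟨x, hx⟩ := exists_hasSum_smul_basis b h
  rw [fracPow, hx.tsum_eq]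
  exact inner_of_hasSum b hx j

lemma hasSum_fracPow {v : Hs Om} (h : inDom lam b ρ v) :
    HasSum (fun j => (lam j ^ ρ * ⟪v, b j⟫) • b j) (fracPow lam b ρ v) := by
  obtain ⟨x, hx⟩ := exists_hasSum_smul_basis b h
  rwa [fracPow, hx.tsum_eq]

lemma hasSum_norm_fracPow_sq {v : Hs Om} (h : inDom lam b ρ v) :
    HasSum (fun j => (lam j ^ ρ * ⟪v, b j⟫) ^ 2) (‖fracPow lam b ρ v‖ ^ 2) := by
  simpa only [inner_fracPow h] using hasSum_inner_sq b (fracPow lam b ρ v)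

lemma fracPow_eq {v x : Hs Om} (h : ∀ j, ⟪x, b j⟫ = lam j ^ ρ * ⟪v, b j⟫) :
    inDom lam b ρ v ∧ fracPow lam b ρ v = x := by
  have h1 : inDom lam b ρ v := by
    have := (hasSum_inner_sq b x).summable
    simp only [h] at this
    exact this
  exact ⟨h1, ext_inner_basis b fun j => by rw [inner_fracPow h1, h]⟩

lemma fracPow_add {v w : Hs Om} (hv : inDom lam b ρ v) (hw : inDom lam b ρ w) :
    inDom lam b ρ (v + w) ∧
      fracPow lam b ρ (v + w) = fracPow lam b ρ v + fracPow lam b ρ w :=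
  fracPow_eq fun j => by
    rw [inner_add_left, inner_add_left, inner_fracPow hv, inner_fracPow hw]; ring

lemma fracPow_smul (c : ℝ) {v : Hs Om} (hv : inDom lam b ρ v) :
    inDom lam b ρ (c • v) ∧ fracPow lam b ρ (c • v) = c • fracPow lam b ρ v :=
  fracPow_eq fun j => by
    rw [inner_smul_left, inner_smul_left, inner_fracPow hv]; simp; ring

lemma fracPow_sub {v w : Hs Om} (hv : inDom lam b ρ v) (hw : inDom lam b ρ w) :
    inDom lam b ρ (v - w) ∧
      fracPow lam b ρ (v - w) = fracPow lam b ρ v - fracPow lam b ρ w :=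
  fracPow_eq fun j => by
    rw [inner_sub_left, inner_sub_left, inner_fracPow hv, inner_fracPow hw]; ring

lemma fracPow_basis (j : ℕ) :
    inDom lam b ρ (b j) ∧ fracPow lam b ρ (b j) = lam j ^ ρ • b j :=
  fracPow_eq fun i => by
    rw [inner_smul_left, inner_basis]
    by_cases hij : j = i <;> simp [hij]

lemma inner_fracPow_basis {v : Hs Om} (h : inDom lam b ρ v) (j : ℕ) :
    ⟪fracPow lam b ρ v, fracPow lam b ρ (b j)⟫ = (lam j ^ ρ) ^ 2 * ⟪v, b j⟫ := by
  rw [(fracPow_basis j).2, inner_smul_right, inner_fracPow h]; ring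

variable (b) in
lemma exists_inDom_norm_sub_lt (lam : ℕ → ℝ) (ρ : ℝ) (v : Hs Om) {ε : ℝ} (hε : 0 < ε) :
    ∃ w, inDom lam b ρ w ∧ ‖v - w‖ < ε := by
  have h := (b.hasSum_repr v).tendsto_sum_nat
  obtain ⟨n, hn⟩ := ((Metric.tendsto_nhds.1 h) ε hε).exists
  refine ⟨_, ?_, by rw [dist_comm, dist_eq_norm] at hn; exact hn⟩
  have hz : inDom lam b ρ 0 := (fracPow_eq (x := 0) fun j => by simp).1
  exact Finset.sum_induction _ (fun w => inDom lam b ρ w)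
    (fun x y hx hy => (fracPow_add hx hy).1) hz
    (fun j _ => (fracPow_smul _ (fracPow_basis j).1).1)

/-- The low-frequency coefficients control everything up to the graph norm. -/
lemma exists_mul_norm_sq_le (hlam : Tendsto lam atTop atTop) (hρ : 0 < ρ) {K : ℝ} (hK : 0 ≤ K) :
    ∃ N : ℕ, ∀ v : Hs Om, inDom lam b ρ v →
      K * ‖v‖ ^ 2 ≤ K * (∑ j ∈ Finset.range N, ⟪v, b j⟫ ^ 2) + ‖fracPow lam b ρ v‖ ^ 2 := by
  have h1 : Tendsto (fun j => lam j ^ ρ) atTop atTop := (_root_.tendsto_rpow_atTop hρ).comp hlam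
  obtain ⟨N, hN⟩ := eventually_atTop.1 (h1.eventually_ge_atTop (√K))
  refine ⟨N, fun v hv => ?_⟩
  have h2 : HasSum (fun j => K * (if j ∈ Finset.range N then ⟪v, b j⟫ ^ 2 else 0))
      (K * ∑ j ∈ Finset.range N, ⟪v, b j⟫ ^ 2) := by
    refine HasSum.mul_left K ?_
    have : HasSum (fun j => if j ∈ Finset.range N then ⟪v, b j⟫ ^ 2 else 0)
        (∑ j ∈ Finset.range N, if j ∈ Finset.range N then ⟪v, b j⟫ ^ 2 else 0) :=
      hasSum_sum_of_ne_finset_zero fun j hj => by simp only [hj, if_false]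
    rwa [Finset.sum_ite_mem, Finset.inter_self] at this
  refine hasSum_le (fun j => ?_) ((hasSum_inner_sq b v).mul_left K)
    (h2.add (hasSum_norm_fracPow_sq hv))
  by_cases hj : j ∈ Finset.range N
  · simp only [hj, if_true]
    nlinarith [sq_nonneg (lam j ^ ρ * ⟪v, b j⟫)]
  · simp only [hj, if_false, mul_zero, zero_add, mul_pow]
    have := hN j (by simpa using hj)
    have hs := pow_le_pow_left₀ (Real.sqrt_nonneg K) this 2
    rw [Real.sq_sqrt hK] at hs
    exact mul_le_mul_of_nonneg_right hs (sq_nonneg _)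

/-- An Ehrling-type interpolation inequality between the domains of two fractional powers. -/
lemma exists_ehrling {lamA : ℕ → ℝ} {r : ℝ} {bA : HilbertBasis ℕ ℝ (Hs Om)}
    (hlam : Tendsto lam atTop atTop) (hρ : 0 < ρ) {K : ℝ} (hK : 0 ≤ K) :
    ∃ C : ℝ, 0 ≤ C ∧ ∀ w a : Hs Om, inDom lam b ρ w →
      (∀ v, inDom lamA bA r v → ⟪w, v⟫ = -⟪a, fracPow lamA bA r v⟫) →
      K * ‖w‖ ^ 2 ≤ ‖fracPow lam b ρ w‖ ^ 2 + C * ‖a‖ ^ 2 := by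
  obtain ⟨N, hN⟩ := exists_mul_norm_sq_le (b := b) hlam hρ (K := 2 * K) (by positivity)
  set η : ℝ := 1 / (2 * ((N : ℝ) + 1)) with hη
  have hη0 : 0 < η := by positivity
  have hηN : 4 * N * η ^ 2 ≤ 1 := by
    rw [hη, div_pow, mul_pow, one_pow, mul_one_div, div_le_one (by positivity)]
    nlinarith [N.cast_nonneg (α := ℝ)]
  choose V hV1 hV2 using fun j => exists_inDom_norm_sub_lt bA lamA r (b j) hη0
  refine ⟨4 * K * ∑ j ∈ Finset.range N, ‖fracPow lamA bA r (V j)‖ ^ 2, by positivity,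
    fun w a hw ha => ?_⟩
  have hj : ∀ j, ⟪w, b j⟫ ^ 2 ≤ 2 * η ^ 2 * ‖w‖ ^ 2
      + 2 * ‖a‖ ^ 2 * ‖fracPow lamA bA r (V j)‖ ^ 2 := by
    intro j
    have e1 : ⟪w, b j⟫ = ⟪w, b j - V j⟫ + -⟪a, fracPow lamA bA r (V j)⟫ := by
      rw [← ha _ (hV1 j), inner_sub_right]; ring
    have e2 : |⟪w, b j - V j⟫| ≤ ‖w‖ * η :=
      (abs_real_inner_le_norm _ _).trans (by gcongr; exact (hV2 j).le)
    have e3 := abs_real_inner_le_norm a (fracPow lamA bA r (V j))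
    have e4 := sq_le_sq' (abs_le.1 e2).1 (abs_le.1 e2).2
    have e5 := sq_le_sq' (abs_le.1 e3).1 (abs_le.1 e3).2
    rw [e1]
    nlinarith [sq_nonneg (⟪w, b j - V j⟫ + ⟪a, fracPow lamA bA r (V j)⟫)]
  have hs := Finset.sum_le_sum fun j (_ : j ∈ Finset.range N) => hj j
  rw [Finset.sum_add_distrib, Finset.sum_const, Finset.card_range, ← Finset.mul_sum,
    nsmul_eq_mul] at hs
  have h1 := hN w hw
  set S := ∑ j ∈ Finset.range N, ‖fracPow lamA bA r (V j)‖ ^ 2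
  have h2 := mul_le_mul_of_nonneg_left hs (by positivity : 0 ≤ 2 * K)
  have h3 : K * (4 * N * η ^ 2) * ‖w‖ ^ 2 ≤ K * 1 * ‖w‖ ^ 2 := by gcongr
  nlinarith

lemma inDom_of_tendsto {v : ℕ → Hs Om} {w : Hs Om} {C : ℝ} (hv : ∀ n, inDom lam b ρ (v n))
    (hC : ∀ n, ‖fracPow lam b ρ (v n)‖ ^ 2 ≤ C)
    (hlim : ∀ j, Tendsto (fun n => ⟪v n, b j⟫) atTop (𝓝 ⟪w, b j⟫)) : inDom lam b ρ w := by
  refine summable_of_sum_le (c := C) (fun j => sq_nonneg _) fun s => ?_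
  have h1 : Tendsto (fun n => ∑ j ∈ s, (lam j ^ ρ * ⟪v n, b j⟫) ^ 2) atTop
      (𝓝 (∑ j ∈ s, (lam j ^ ρ * ⟪w, b j⟫) ^ 2)) :=
    tendsto_finsetSum _ fun j _ => ((hlim j).const_mul _).pow 2
  refine le_of_tendsto h1 (Eventually.of_forall fun n => ?_)
  exact (sum_le_hasSum s (fun j _ => sq_nonneg _) (hasSum_norm_fracPow_sq (hv n))).trans (hC n)

/-- Compactness of the embedding of the domain, for sequences. -/
lemma tendsto_of_inner_basis {v : ℕ → Hs Om} {w : Hs Om} {C : ℝ}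
    (hlam : Tendsto lam atTop atTop) (hρ : 0 < ρ) (hv : ∀ n, inDom lam b ρ (v n))
    (hw : inDom lam b ρ w) (hC : ∀ n, ‖fracPow lam b ρ (v n)‖ ≤ C)
    (hlim : ∀ j, Tendsto (fun n => ⟪v n, b j⟫) atTop (𝓝 ⟪w, b j⟫)) :
    Tendsto v atTop (𝓝 w) := by
  rw [Metric.tendsto_atTop]
  intro ε hε
  set D := C + ‖fracPow lam b ρ w‖ with hD
  have hD0 : 0 ≤ D := by
    have := (norm_nonneg _).trans (hC 0)
    positivity
  set K : ℝ := 4 * (D ^ 2 + 1) / ε ^ 2 with hKd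
  have hK : 0 < K := by positivity
  obtain ⟨N, hN⟩ := exists_mul_norm_sq_le (b := b) hlam hρ hK.le
  have h1 : Tendsto (fun n => ∑ j ∈ Finset.range N, ⟪v n - w, b j⟫ ^ 2) atTop (𝓝 0) := by
    have : Tendsto (fun n => ∑ j ∈ Finset.range N, ⟪v n - w, b j⟫ ^ 2) atTop
        (𝓝 (∑ j ∈ Finset.range N, (⟪w, b j⟫ - ⟪w, b j⟫) ^ 2)) := by
      simp_rw [inner_sub_left]
      exact tendsto_finsetSum _ fun j _ => ((hlim j).sub_const _).pow 2
    simpa using this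
  obtain ⟨n0, hn0⟩ := eventually_atTop.1 (h1.eventually_lt_const (u := ε ^ 2 / 2) (by positivity))
  refine ⟨n0, fun n hn => ?_⟩
  have h2 := hN _ (fracPow_sub (hv n) hw).1
  rw [(fracPow_sub (hv n) hw).2] at h2
  have h3 : ‖fracPow lam b ρ (v n) - fracPow lam b ρ w‖ ^ 2 ≤ D ^ 2 :=
    pow_le_pow_left₀ (norm_nonneg _) ((norm_sub_le _ _).trans (by rw [hD]; gcongr; exact hC n)) 2
  have h4 := mul_lt_mul_of_pos_left (hn0 n hn) hK
  have h5 : K * (ε ^ 2 / 2) = 2 * (D ^ 2 + 1) := by rw [hKd]; field_simp; ring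
  have h6 : K * ε ^ 2 = 4 * (D ^ 2 + 1) := by rw [hKd]; field_simp
  rw [dist_eq_norm]
  have h7 : ‖v n - w‖ ^ 2 < ε ^ 2 := by
    have : K * ‖v n - w‖ ^ 2 < K * ε ^ 2 := by nlinarith
    exact lt_of_mul_lt_mul_left this hK.le
  exact lt_of_pow_lt_pow_left₀ 2 hε.le h7

/-- A bounded sequence converging against a Hilbert basis converges weakly. -/
lemma tendsto_inner_of_basis {v : ℕ → Hs Om} {w : Hs Om} {M : ℝ}
    (hM : ∀ n, ‖v n‖ ≤ M)
    (hlim : ∀ j, Tendsto (fun n => ⟪v n, b j⟫) atTop (𝓝 ⟪w, b j⟫)) (x : Hs Om) :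
    Tendsto (fun n => ⟪v n, x⟫) atTop (𝓝 ⟪w, x⟫) := by
  have hspan : ∀ φ ∈ Submodule.span ℝ (range b),
      Tendsto (fun n => ⟪v n, φ⟫) atTop (𝓝 ⟪w, φ⟫) := by
    intro φ hφ
    induction hφ using Submodule.span_induction with
    | mem φ h =>
      obtain ⟨j, rfl⟩ := h
      exact hlim j
    | zero => simp
    | add φ ψ _ _ h1 h2 => simpa only [inner_add_right] using h1.add h2
    | smul c φ _ h => simpa only [real_inner_smul_right] using h.const_mul c
  have hx : x ∈ (Submodule.span ℝ (range b)).topologicalClosure := by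
    rw [b.dense_span]
    exact Submodule.mem_top
  rw [Metric.tendsto_atTop]
  intro ε hε
  have hM0 : 0 ≤ M := (norm_nonneg _).trans (hM 0)
  obtain ⟨φ, hφ, hx⟩ := Metric.mem_closure_iff.1 hx (ε / (2 * (M + ‖w‖ + 1))) (by positivity)
  rw [dist_eq_norm] at hx
  obtain ⟨n0, hn0⟩ := (Metric.tendsto_atTop.1 (hspan φ hφ)) (ε / 2) (by positivity)
  refine ⟨n0, fun n hn => ?_⟩
  have h1 := hn0 n hn
  rw [Real.dist_eq] at h1 ⊢
  have e1 : ⟪v n, x⟫ - ⟪w, x⟫ = ⟪v n - w, x - φ⟫ + (⟪v n, φ⟫ - ⟪w, φ⟫) := by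
    simp only [inner_sub_left, inner_sub_right]; ring
  have e2 : |⟪v n - w, x - φ⟫| ≤ (M + ‖w‖ + 1) * (ε / (2 * (M + ‖w‖ + 1))) := by
    refine (abs_real_inner_le_norm _ _).trans ?_
    have := norm_sub_le (v n) w
    gcongr
    linarith [hM n]
  have e3 : (M + ‖w‖ + 1) * (ε / (2 * (M + ‖w‖ + 1))) = ε / 2 := by field_simp
  rw [e1]
  exact (abs_add_le _ _).trans_lt (by linarith)

lemma poincare (hmono : Monotone lam) (h1 : 0 < lam 1) (hρ : 0 < ρ) {v : Hs Om}
    (hv : inDom lam b ρ v) :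
    lam 1 ^ ρ * ‖v - ⟪v, b 0⟫ • b 0‖ ≤ ‖fracPow lam b ρ v‖ := by
  have h : (lam 1 ^ ρ * ‖v - ⟪v, b 0⟫ • b 0‖) ^ 2 ≤ ‖fracPow lam b ρ v‖ ^ 2 := by
    rw [mul_pow]
    refine hasSum_le (fun j => ?_) ((hasSum_inner_sq b _).mul_left _) (hasSum_norm_fracPow_sq hv)
    rw [inner_sub_left, inner_smul_left, inner_basis, mul_pow]
    by_cases hj : 0 = j
    · subst hj
      simp only [if_true, RCLike.conj_to_real, mul_one, sub_self]
      rw [zero_pow two_ne_zero, mul_zero]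
      positivity
    · simp only [hj, if_false, mul_zero, sub_zero]
      have : lam 1 ≤ lam j := hmono (Nat.one_le_iff_ne_zero.2 fun h => hj h.symm)
      gcongr
  exact le_of_sq_le_sq h (norm_nonneg _)

end Spectral

section Superposition

variable {Om : Set E3}

lemma inner_eq_integral (f g : Hs Om) : ⟪f, g⟫ = ∫ x, f x * g x ∂(mOm Om) := by
  rw [L2.inner_def]
  exact integral_congr_ae (Eventually.of_forall fun x => mul_comm _ _)

lemma integrable_mul (f h : Hs Om) : Integrable (fun x => f x * h x) (mOm Om) :=
  (Lp.memLp f).integrable_mul (Lp.memLp h)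

variable [IsFiniteMeasure (mOm Om)] {K : ℝ≥0} {g : ℝ → ℝ}

lemma memLp_comp_lipschitz (hg : LipschitzWith K g) (v : Hs Om) :
    MemLp (fun x => g (v x)) 2 (mOm Om) := by
  have h1 : LipschitzWith K fun s => g s - g 0 := by
    refine LipschitzWith.of_dist_le_mul fun s t => ?_
    simpa [dist_sub_right] using hg.dist_le_mul s t
  have h2 := (h1.comp_memLp (by simp) (Lp.memLp v)).add (memLp_const (g 0))
  refine (memLp_congr_ae (Eventually.of_forall fun x => ?_)).1 h2
  simp

/-- The superposition operator on `L²(Om)` induced by a Lipschitz function. -/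
def superpos (g : ℝ → ℝ) (hg : LipschitzWith K g) (v : Hs Om) : Hs Om :=
  (memLp_comp_lipschitz hg v).toLp _

lemma coeFn_superpos (hg : LipschitzWith K g) (v : Hs Om) :
    superpos g hg v =ᵐ[mOm Om] fun x => g (v x) :=
  MemLp.coeFn_toLp _

lemma lipschitzWith_superpos (hg : LipschitzWith K g) :
    LipschitzWith K (superpos (Om := Om) g hg) := by
  refine LipschitzWith.of_dist_le_mul fun v w => ?_
  rw [dist_eq_norm, dist_eq_norm]
  refine Lp.norm_le_mul_norm_of_ae_le_mul ?_
  filter_upwards [Lp.coeFn_sub (superpos g hg v) (superpos g hg w), Lp.coeFn_sub v w,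
    coeFn_superpos hg v, coeFn_superpos hg w] with x h1 h2 h3 h4
  rw [h1, h2, Pi.sub_apply, Pi.sub_apply, h3, h4, ← dist_eq_norm, ← dist_eq_norm]
  exact hg.dist_le_mul _ _

lemma coeFn_const_one : (Lp.const 2 (mOm Om) (1 : ℝ) : Hs Om) =ᵐ[mOm Om] fun _ => (1 : ℝ) :=
  Lp.coeFn_const ..

lemma integral_eq_inner_one (v : Hs Om) :
    ∫ x, v x ∂(mOm Om) = ⟪v, Lp.const 2 (mOm Om) (1 : ℝ)⟫ := by
  rw [inner_eq_integral]
  refine integral_congr_ae ?_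
  filter_upwards [coeFn_const_one] with x hx
  rw [hx, mul_one]

lemma integral_superpos (hg : LipschitzWith K g) (v : Hs Om) :
    ∫ x, g (v x) ∂(mOm Om) = ⟪superpos g hg v, Lp.const 2 (mOm Om) (1 : ℝ)⟫ := by
  rw [← integral_eq_inner_one]
  exact integral_congr_ae (coeFn_superpos hg v).symm

lemma integral_sub_mul_sub (hg : LipschitzWith K g) (y u v w : Hs Om) :
    ∫ x, (g (y x) - u x) * (v x - w x) ∂(mOm Om) = ⟪superpos g hg y - u, v - w⟫ := by
  rw [inner_eq_integral]
  refine integral_congr_ae ?_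
  filter_upwards [Lp.coeFn_sub (superpos g hg y) u, Lp.coeFn_sub v w,
    coeFn_superpos hg y] with x h1 h2 h3
  rw [h1, h2, Pi.sub_apply, Pi.sub_apply, h3]

end Superposition

section Potential

variable {Om : Set E3} [IsFiniteMeasure (mOm Om)] {betah : ℝ → ℝ≥0∞} {I : Set ℝ} {Bd : ℝ}

lemma lintegral_comp_lt_top (hbd : ∀ s ∈ I, betah s ≤ ENNReal.ofReal Bd) {v : Hs Om}
    (hv : ∀ᵐ x ∂(mOm Om), v x ∈ I) : (∫⁻ x, betah (v x) ∂(mOm Om)) < ⊤ := by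
  refine (lintegral_mono_ae (hv.mono fun x hx => hbd _ hx)).trans_lt ?_
  rw [lintegral_const]
  exact ENNReal.mul_lt_top ENNReal.ofReal_lt_top (measure_lt_top _ _)

lemma toReal_lintegral_comp (hlsc : LowerSemicontinuous betah)
    (hbd : ∀ s ∈ I, betah s ≤ ENNReal.ofReal Bd) {v : Hs Om}
    (hv : ∀ᵐ x ∂(mOm Om), v x ∈ I) :
    Integrable (fun x => (betah (v x)).toReal) (mOm Om) ∧
      (∫⁻ x, betah (v x) ∂(mOm Om)).toReal = ∫ x, (betah (v x)).toReal ∂(mOm Om) := by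
  have hm : AEMeasurable (fun x => betah (v x)) (mOm Om) :=
    hlsc.measurable.comp_aemeasurable (Lp.aestronglyMeasurable v).aemeasurable
  refine ⟨integrable_toReal_of_lintegral_ne_top hm (lintegral_comp_lt_top hbd hv).ne, ?_⟩
  rw [integral_toReal hm]
  exact hv.mono fun x hx => (hbd _ hx).trans_lt ENNReal.ofReal_lt_top

lemma potential_sub_le {L : ℝ≥0} {g : ℝ → ℝ} (hg : LipschitzWith L g)
    (hlsc : LowerSemicontinuous betah) (hbd : ∀ s ∈ I, betah s ≤ ENNReal.ofReal Bd)
    (hsub : ∀ s ∈ I, ∀ t ∈ I, (betah s).toReal + g s * (t - s) ≤ (betah t).toReal)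
    {v w : Hs Om} (hv : ∀ᵐ x ∂(mOm Om), v x ∈ I) (hw : ∀ᵐ x ∂(mOm Om), w x ∈ I) :
    (∫⁻ x, betah (v x) ∂(mOm Om)).toReal - (∫⁻ x, betah (w x) ∂(mOm Om)).toReal
      ≤ ⟪superpos g hg w, v - w⟫ + L * ‖v - w‖ ^ 2 := by
  obtain ⟨i1, e1⟩ := toReal_lintegral_comp hlsc hbd hv
  obtain ⟨i2, e2⟩ := toReal_lintegral_comp hlsc hbd hw
  have i3 := integrable_mul (superpos g hg w) (v - w)
  have i4 := integrable_mul (v - w) (v - w)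
  rw [e1, e2, ← integral_sub i1 i2, ← real_inner_self_eq_norm_sq, inner_eq_integral,
    inner_eq_integral, ← integral_const_mul, ← integral_add i3 (i4.const_mul _)]
  refine integral_mono_ae (i1.sub i2) (i3.add (i4.const_mul _)) ?_
  filter_upwards [hv, hw, Lp.coeFn_sub v w, coeFn_superpos hg w] with x h1 h2 h3 h4
  simp only [h3, h4, Pi.sub_apply]
  have h5 := hsub _ h1 _ h2
  have h6 : (g (v x) - g (w x)) * (v x - w x) ≤ L * ((v x - w x) * (v x - w x)) := by
    have := hg.dist_le_mul (v x) (w x)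
    rw [Real.dist_eq, Real.dist_eq] at this
    calc (g (v x) - g (w x)) * (v x - w x) ≤ |g (v x) - g (w x)| * |v x - w x| := by
          rw [← abs_mul]; exact le_abs_self _
      _ ≤ L * |v x - w x| * |v x - w x| := by gcongr
      _ = L * ((v x - w x) * (v x - w x)) := by rw [mul_assoc, abs_mul_abs_self]
  linarith

end Potential

lemma eq_zero_of_forall_small {Q N s0 : ℝ} (hs0 : 0 < s0) (hN : 0 ≤ N)
    (h : ∀ s, |s| ≤ s0 → 0 ≤ s * Q + N * s ^ 2) : Q = 0 := by
  by_contra hQ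
  have hQ' : 0 < |Q| := abs_pos.2 hQ
  set ε := min (s0 / |Q|) (1 / (2 * (N + 1))) with hε
  have hε0 : 0 < ε := lt_min (by positivity) (by positivity)
  have h1 : ε * |Q| ≤ s0 := by
    have := min_le_left (s0 / |Q|) (1 / (2 * (N + 1)))
    rwa [← hε, le_div_iff₀ hQ'] at this
  have h2 : ε * (2 * (N + 1)) ≤ 1 := by
    have := min_le_right (s0 / |Q|) (1 / (2 * (N + 1)))
    rwa [← hε, le_div_iff₀ (by positivity)] at this
  have h3 := h (-(ε * Q)) (by rw [abs_neg, abs_mul, abs_of_pos hε0]; exact h1)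
  have h4 : 0 < ε * Q ^ 2 := by positivity
  have h5 : -(ε * Q) * Q + N * (-(ε * Q)) ^ 2 = ε * Q ^ 2 * (N * ε - 1) := by ring
  rw [h5] at h3
  have h6 : 0 ≤ N * ε - 1 := nonneg_of_mul_nonneg_right h3 h4
  nlinarith

lemma weak_eq_of_dense {Om : Set E3} {lam : ℕ → ℝ} {ρ : ℝ} {e : HilbertBasis ℕ ℝ (Hs Om)}
    (hdense : ∀ v : Hs Om, inDom lam e ρ v → ∀ ε : ℝ, 0 < ε →
      ∃ w : Hs Om, inDom lam e ρ w ∧ (∃ C : ℝ, ∀ᵐ x ∂(mOm Om), |w x| ≤ C) ∧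
        gnormSq lam e ρ (v - w) < ε)
    {F R : Hs Om}
    (hb : ∀ φ : Hs Om, inDom lam e ρ φ → (∃ C : ℝ, ∀ᵐ x ∂(mOm Om), |φ x| ≤ C) →
      ⟪F, fracPow lam e ρ φ⟫ + ⟪R, φ⟫ = 0)
    {φ : Hs Om} (hφ : inDom lam e ρ φ) :
    ⟪F, fracPow lam e ρ φ⟫ + ⟪R, φ⟫ = 0 := by
  set Q := ⟪F, fracPow lam e ρ φ⟫ + ⟪R, φ⟫ with hQ
  have key : ∀ ε : ℝ, 0 < ε → Q ^ 2 ≤ 2 * (‖F‖ ^ 2 + ‖R‖ ^ 2) * ε := by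
    intro ε hε
    obtain ⟨w, hw, hC, hlt⟩ := hdense φ hφ ε hε
    have h1 := hb w hw hC
    have h2 : Q = ⟪F, fracPow lam e ρ (φ - w)⟫ + ⟪R, φ - w⟫ := by
      rw [(fracPow_sub hφ hw).2, inner_sub_right, inner_sub_right]; linarith
    have h3 := abs_real_inner_le_norm F (fracPow lam e ρ (φ - w))
    have h4 := abs_real_inner_le_norm R (φ - w)
    have h5 := sq_le_sq' (abs_le.1 h3).1 (abs_le.1 h3).2
    have h6 := sq_le_sq' (abs_le.1 h4).1 (abs_le.1 h4).2
    simp only [gnormSq] at hlt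
    set x := ⟪F, fracPow lam e ρ (φ - w)⟫
    set y := ⟪R, φ - w⟫
    rw [h2]
    have h7 : ‖fracPow lam e ρ (φ - w)‖ ^ 2 ≤ ε := by nlinarith [sq_nonneg ‖φ - w‖]
    have h8 : ‖φ - w‖ ^ 2 ≤ ε := by nlinarith [sq_nonneg ‖fracPow lam e ρ (φ - w)‖]
    have h9 := mul_le_mul_of_nonneg_left h7 (sq_nonneg ‖F‖)
    have h10 := mul_le_mul_of_nonneg_left h8 (sq_nonneg ‖R‖)
    nlinarith [sq_nonneg (x - y)]
  have h0 : Q ^ 2 ≤ 0 := by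
    refine le_of_forall_pos_le_add fun ε hε => ?_
    have := key (ε / (2 * (‖F‖ ^ 2 + ‖R‖ ^ 2) + 1)) (by positivity)
    refine this.trans ?_
    rw [zero_add, mul_div_assoc', div_le_iff₀ (by positivity)]
    nlinarith
  exact pow_eq_zero_iff two_ne_zero |>.1 (le_antisymm h0 (sq_nonneg _))

section WeakEquation

variable {Om : Set E3} [IsFiniteMeasure (mOm Om)] {betah : ℝ → ℝ≥0∞} {a b δ Bd : ℝ}
  {L : ℝ≥0} {g : ℝ → ℝ} {lam : ℕ → ℝ} {ρ : ℝ} {e : HilbertBasis ℕ ℝ (Hs Om)}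

/-- The variational inequality reduces to an equation, tested against bounded functions. -/
lemma weak_eq_of_bounded (hg : LipschitzWith L g) (hlsc : LowerSemicontinuous betah) (hδ : 0 < δ)
    (hbd : ∀ s ∈ Icc (a - δ) (b + δ), betah s ≤ ENNReal.ofReal Bd)
    (hsub : ∀ s ∈ Icc (a - δ) (b + δ), ∀ t ∈ Icc (a - δ) (b + δ),
      (betah s).toReal + g s * (t - s) ≤ (betah t).toReal)
    {w p M : Hs Om} (hw : inDom lam e ρ w) (hwab : ∀ᵐ x ∂(mOm Om), w x ∈ Icc a b)
    (hineq : ∀ v : Hs Om, inDom lam e ρ v → (∫⁻ x, betah (v x) ∂(mOm Om)) < ⊤ →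
      ⟪fracPow lam e ρ w, fracPow lam e ρ w - fracPow lam e ρ v⟫
        + (∫⁻ x, betah (w x) ∂(mOm Om)).toReal + ⟪p, w - v⟫
        ≤ ⟪M, w - v⟫ + (∫⁻ x, betah (v x) ∂(mOm Om)).toReal)
    {φ : Hs Om} (hφ : inDom lam e ρ φ) {C : ℝ} (hC : ∀ᵐ x ∂(mOm Om), |φ x| ≤ C) :
    ⟪fracPow lam e ρ w, fracPow lam e ρ φ⟫ + ⟪superpos g hg w + p - M, φ⟫ = 0 := by
  refine eq_zero_of_forall_small (s0 := δ / (|C| + 1)) (N := L * ‖φ‖ ^ 2) (by positivity)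
    (by positivity) fun s hs => ?_
  rw [le_div_iff₀ (by positivity)] at hs
  obtain ⟨h1, h2⟩ := fracPow_smul s hφ
  obtain ⟨h3, h4⟩ := fracPow_add hw h1
  have hw' : ∀ᵐ x ∂(mOm Om), w x ∈ Icc (a - δ) (b + δ) :=
    hwab.mono fun x hx => ⟨by linarith [hx.1], by linarith [hx.2]⟩
  have hv : ∀ᵐ x ∂(mOm Om), (w + s • φ) x ∈ Icc (a - δ) (b + δ) := by
    filter_upwards [Lp.coeFn_add w (s • φ), Lp.coeFn_smul s φ, hC, hwab] with x e1 e2 e3 e4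
    rw [e1, Pi.add_apply, e2, Pi.smul_apply, smul_eq_mul]
    have : |s * φ x| ≤ δ := by
      rw [abs_mul]
      refine le_trans ?_ hs
      gcongr
      linarith [le_abs_self C]
    exact ⟨by linarith [(abs_le.1 this).1, e4.1], by linarith [(abs_le.1 this).2, e4.2]⟩
  have h5 := hineq _ h3 (lintegral_comp_lt_top hbd hv)
  have h6 := potential_sub_le hg hlsc hbd hsub hv hw'
  rw [h4, h2, sub_add_cancel_left, sub_add_cancel_left] at h5
  rw [add_sub_cancel_left, norm_smul, mul_pow, Real.norm_eq_abs, sq_abs] at h6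
  simp only [inner_neg_right, inner_smul_right] at h5 h6
  rw [inner_sub_left, inner_add_left]
  nlinarith

end WeakEquation

section Nonlinearity

lemma primitive_sub_le {pih piF : ℝ → ℝ} {L : ℝ≥0} (hd : ∀ s, HasDerivAt pih (piF s) s)
    (hL : LipschitzWith L piF) (p q : ℝ) :
    pih p - pih q ≤ piF p * (p - q) + L * (p - q) ^ 2 := by
  have h := (convex_uIcc q p).norm_image_sub_le_of_norm_hasDerivWithin_le
    (f := fun s => pih s - piF p * s) (f' := fun s => piF s - piF p) (C := L * |p - q|)
    (fun s _ => by
      have h1 := ((hd s).sub ((hasDerivAt_id s).const_mul (piF p))).hasDerivWithinAt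
        (s := uIcc q p)
      rw [mul_one] at h1
      exact h1)
    (fun s hs => by
      rw [← dist_eq_norm]
      refine (hL.dist_le_mul s p).trans ?_
      gcongr
      rw [Real.dist_eq]
      have := abs_sub_right_of_mem_uIcc hs
      rwa [abs_sub_comm s p])
    left_mem_uIcc right_mem_uIcc
  rw [Real.norm_eq_abs, Real.norm_eq_abs, mul_assoc, abs_mul_abs_self] at h
  have := (abs_le.1 h).2
  nlinarith

variable {betah : ℝ → ℝ≥0∞} {bfun : ℝ → ℝ} {a b : ℝ}

/-- Regularity of a convex potential near a compact interval inside the domain of its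
subdifferential. -/
lemma exists_regular_extension
    (hDopen : IsOpen {s : ℝ | (subdiff betah s).Nonempty})
    (hDconn : Set.OrdConnected {s : ℝ | (subdiff betah s).Nonempty})
    (hbC1 : ContDiffOn ℝ 1 bfun {s : ℝ | (subdiff betah s).Nonempty})
    (hbsingle : ∀ s ∈ {s : ℝ | (subdiff betah s).Nonempty}, subdiff betah s = {bfun s})
    (hab : a ≤ b) (habD : Set.Icc a b ⊆ {s : ℝ | (subdiff betah s).Nonempty}) :
    ∃ (δ Bd : ℝ) (L : ℝ≥0) (g : ℝ → ℝ), 0 < δ ∧ LipschitzWith L g ∧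
      EqOn bfun g (Icc (a - δ) (b + δ)) ∧
      (∀ s ∈ Icc (a - δ) (b + δ), betah s ≤ ENNReal.ofReal Bd) ∧
      (∀ s ∈ Icc (a - δ) (b + δ), ∀ t ∈ Icc (a - δ) (b + δ),
        (betah s).toReal + g s * (t - s) ≤ (betah t).toReal) := by
  set D := {s : ℝ | (subdiff betah s).Nonempty} with hD
  obtain ⟨δ1, h1, h1'⟩ := Metric.isOpen_iff.1 hDopen a (habD ⟨le_rfl, hab⟩)
  obtain ⟨δ2, h2, h2'⟩ := Metric.isOpen_iff.1 hDopen b (habD ⟨hab, le_rfl⟩)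
  set δ := min δ1 δ2 / 2 with hδ
  have hm : 0 < min δ1 δ2 := lt_min h1 h2
  have hδ0 : 0 < δ := by positivity
  have hID : Icc (a - δ) (b + δ) ⊆ D := by
    refine hDconn.out (h1' ?_) (h2' ?_)
    · rw [Metric.mem_ball, Real.dist_eq, sub_sub_cancel_left, abs_neg, abs_of_pos hδ0]
      linarith [min_le_left δ1 δ2]
    · rw [Metric.mem_ball, Real.dist_eq, add_sub_cancel_left, abs_of_pos hδ0]
      linarith [min_le_right δ1 δ2]
  have hloc : LocallyLipschitzOn (Icc (a - δ) (b + δ)) bfun := by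
    intro x hx
    have hcd : ContDiffAt ℝ 1 bfun x := hbC1.contDiffAt (hDopen.mem_nhds (hID hx))
    obtain ⟨K, t, ht, hK⟩ := hcd.exists_lipschitzOnWith
    exact ⟨K, t, mem_nhdsWithin_of_mem_nhds ht, hK⟩
  obtain ⟨L, hL⟩ := hloc.exists_lipschitzOnWith_of_compact isCompact_Icc
  obtain ⟨g, hg, hbg⟩ := hL.extend_real
  have hfin : ∀ s ∈ Icc (a - δ) (b + δ), betah s < ⊤ := fun s hs => by
    obtain ⟨ξ, hξ⟩ := hID hs
    exact hξ.1
  have hsub : ∀ s ∈ Icc (a - δ) (b + δ), ∀ t ∈ Icc (a - δ) (b + δ),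
      (betah s).toReal + g s * (t - s) ≤ (betah t).toReal := fun s hs t ht => by
    have h3 : bfun s ∈ subdiff betah s := by rw [hbsingle s (hID hs)]; rfl
    rw [← hbg hs]
    exact (ENNReal.ofReal_le_iff_le_toReal (hfin t ht).ne).1 (h3.2 t)
  obtain ⟨M, hM⟩ := (isCompact_Icc (a := a - δ) (b := b + δ)).exists_bound_of_continuousOn
    hg.continuous.continuousOn
  have ha : a ∈ Icc (a - δ) (b + δ) := ⟨by linarith, by linarith⟩
  refine ⟨δ, (betah a).toReal + M * (b - a + 2 * δ), L, g, hδ0, hg, hbg, fun s hs => ?_, hsub⟩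
  rw [ENNReal.le_ofReal_iff_toReal_le (hfin s hs).ne]
  · have h3 := hsub s hs a ha
    have h4 : g s * (s - a) ≤ M * (b - a + 2 * δ) := by
      calc g s * (s - a) ≤ |g s| * |s - a| := by rw [← abs_mul]; exact le_abs_self _
        _ ≤ M * (b - a + 2 * δ) := by
          have : |s - a| ≤ b - a + 2 * δ :=
            abs_le.2 ⟨by linarith [hs.1], by linarith [hs.2]⟩
          exact mul_le_mul (hM s hs) this (abs_nonneg _) ((norm_nonneg _).trans (hM s hs))
    linarith
  · have := (norm_nonneg _).trans (hM a ha)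
    have : 0 ≤ M * (b - a + 2 * δ) := mul_nonneg this (by linarith)
    positivity

/-- On a compact interval the total potential extends to a Lipschitz function. -/
lemma exists_lipschitz_potential {pih piF g : ℝ → ℝ} {L Lpi : ℝ≥0} (hg : LipschitzWith L g)
    (hd : ∀ s, HasDerivAt pih (piF s) s) (hL : LipschitzWith Lpi piF)
    (hsub : ∀ s ∈ Icc a b, ∀ t ∈ Icc a b,
      (betah s).toReal + g s * (t - s) ≤ (betah t).toReal) :
    ∃ (K : ℝ≥0) (k : ℝ → ℝ), LipschitzWith K k ∧
      EqOn (fun s => (betah s).toReal + pih s) k (Icc a b) := by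
  obtain ⟨M, hM⟩ := (isCompact_Icc (a := a) (b := b)).exists_bound_of_continuousOn
    hg.continuous.continuousOn
  obtain ⟨M', hM'⟩ := (isCompact_Icc (a := a) (b := b)).exists_bound_of_continuousOn
    hL.continuous.continuousOn
  have key : ∀ s ∈ Icc a b, ∀ t ∈ Icc a b, ((betah s).toReal + pih s)
      - ((betah t).toReal + pih t) ≤ (M + M' + Lpi * (b - a)) * |s - t| := by
    intro s hs t ht
    have h1 := hsub s hs t ht
    have h2 := primitive_sub_le hd hL s t
    have h3 : g s * (s - t) ≤ M * |s - t| := by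
      refine (le_abs_self _).trans ?_
      rw [abs_mul]
      exact mul_le_mul_of_nonneg_right (hM s hs) (abs_nonneg _)
    have h4 : piF s * (s - t) ≤ M' * |s - t| := by
      refine (le_abs_self _).trans ?_
      rw [abs_mul]
      exact mul_le_mul_of_nonneg_right (hM' s hs) (abs_nonneg _)
    have h5 : (s - t) ^ 2 ≤ (b - a) * |s - t| := by
      rw [← sq_abs, sq]
      exact mul_le_mul_of_nonneg_right
        (abs_le.2 ⟨by linarith [hs.1, ht.2], by linarith [hs.2, ht.1]⟩) (abs_nonneg _)
    have h6 := mul_le_mul_of_nonneg_left h5 Lpi.coe_nonneg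
    nlinarith
  have hLip : LipschitzOnWith (M + M' + Lpi * (b - a)).toNNReal
      (fun s => (betah s).toReal + pih s) (Icc a b) := by
    refine LipschitzOnWith.of_dist_le_mul fun s hs t ht => ?_
    rw [Real.dist_eq, Real.dist_eq]
    have h1 : (M + M' + Lpi * (b - a)) ≤ ((M + M' + Lpi * (b - a)).toNNReal : ℝ) :=
      Real.le_coe_toNNReal _
    have h2 := mul_le_mul_of_nonneg_right h1 (abs_nonneg (s - t))
    refine abs_le.2 ⟨?_, (key s hs t ht).trans h2⟩
    have := key t ht s hs
    rw [abs_sub_comm] at this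
    linarith
  obtain ⟨k, hk, hk'⟩ := hLip.extend_real
  exact ⟨_, k, hk, hk'⟩

end Nonlinearity

lemma le_of_sq_le_add_mul {x P Q : ℝ} (hP : 0 ≤ P) (hQ : 0 ≤ Q) (h : x ^ 2 ≤ P + Q * x) :
    x ≤ P + Q + 1 := by
  by_contra! hx
  have : 0 < (x - (P + Q + 1)) * x := mul_pos (by linarith) (by linarith)
  nlinarith

lemma ae_mem_Icc_of_tendsto {Om : Set E3} [IsFiniteMeasure (mOm Om)] {a b : ℝ} (hab : a ≤ b)
    {v : ℕ → Hs Om} {w : Hs Om} (hv : ∀ n, ∀ᵐ x ∂(mOm Om), v n x ∈ Icc a b)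
    (hlim : Tendsto v atTop (𝓝 w)) : ∀ᵐ x ∂(mOm Om), w x ∈ Icc a b := by
  have hc : LipschitzWith 1 fun s : ℝ => max a (min b s) :=
    (LipschitzWith.id.const_min b).const_max a
  have h1 : ∀ n, superpos _ hc (v n) = v n := fun n => by
    refine Lp.ext ?_
    filter_upwards [coeFn_superpos hc (v n), hv n] with x hx hx'
    rw [hx, min_eq_right hx'.2, max_eq_right hx'.1]
  have h2 : superpos _ hc w = w := by
    have := ((lipschitzWith_superpos (Om := Om) hc).continuous.tendsto w).comp hlim
    refine tendsto_nhds_unique (this.congr fun n => ?_) hlim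
    exact h1 n
  filter_upwards [coeFn_superpos hc w] with x hx
  rw [h2] at hx
  rw [hx]
  exact ⟨le_max_left _ _, max_le hab (min_le_left _ _)⟩

lemma exists_stationary_limit {Om : Set E3} {lamA lamB : ℕ → ℝ} {r σ : ℝ}
    {bA bB : HilbertBasis ℕ ℝ (Hs Om)}
    (hlamB : Tendsto lamB atTop atTop) (hσ : 0 < σ) (hmonoA : Monotone lamA) (h1 : 0 < lamA 1)
    (hr : 0 < r)
    (hdense : ∀ v : Hs Om, inDom lamB bB σ v → ∀ ε : ℝ, 0 < ε →
      ∃ w : Hs Om, inDom lamB bB σ w ∧ (∃ C : ℝ, ∀ᵐ x ∂(mOm Om), |w x| ≤ C) ∧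
        gnormSq lamB bB σ (v - w) < ε)
    (he : inDom lamB bB σ (bA 0)) (hebd : ∃ C : ℝ, ∀ᵐ x ∂(mOm Om), |bA 0 x| ≤ C)
    {G : Hs Om → Hs Om} (hG : Continuous G) {v μ R : ℕ → Hs Om} {w F : Hs Om} {M CG : ℝ}
    (hvM : ∀ n, ‖v n‖ ≤ M) (hGM : ∀ n, ‖G (v n)‖ ≤ CG)
    (hv : ∀ n, inDom lamB bB σ (v n)) (hvbd : ∀ n, ∃ C : ℝ, ∀ᵐ x ∂(mOm Om), |v n x| ≤ C)
    (hμ : ∀ n, inDom lamA bA r (μ n))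
    (hm : Tendsto (fun n => fracPow lamA bA r (μ n)) atTop (𝓝 0))
    (hR : Tendsto R atTop (𝓝 F))
    (hweak : ∀ n φ, inDom lamB bB σ φ → (∃ C : ℝ, ∀ᵐ x ∂(mOm Om), |φ x| ≤ C) →
      ⟪fracPow lamB bB σ (v n), fracPow lamB bB σ φ⟫ + ⟪G (v n) - R n - μ n, φ⟫ = 0)
    (hw : inDom lamB bB σ w)
    (hlim : ∀ j, Tendsto (fun n => ⟪v n, bB j⟫) atTop (𝓝 ⟪w, bB j⟫)) :
    Tendsto v atTop (𝓝 w) ∧ ∃ κ : ℝ, ∀ j,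
      (lamB j ^ σ) ^ 2 * ⟪w, bB j⟫ + ⟪G w - F - κ • bA 0, bB j⟫ = 0 := by
  set e := bA 0 with he_def
  have hen : ‖e‖ = 1 := bA.orthonormal.1 0
  set κ : ℕ → ℝ := fun n => ⟪μ n, e⟫ with hκ
  set d : ℕ → Hs Om := fun n => μ n - κ n • e with hd
  have hlp : 0 < lamA 1 ^ r := Real.rpow_pos_of_pos h1 _
  have hd0 : Tendsto d atTop (𝓝 0) := by
    refine squeeze_zero_norm (a := fun n => (lamA 1 ^ r)⁻¹ * ‖fracPow lamA bA r (μ n)‖)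
      (fun n => ?_) (by simpa using hm.norm.const_mul (lamA 1 ^ r)⁻¹)
    rw [inv_mul_eq_div, le_div_iff₀ hlp, mul_comm]
    exact poincare hmonoA h1 hr (hμ n)
  obtain ⟨CR, hCR⟩ := hR.norm.bddAbove_range
  obtain ⟨Cd, hCd⟩ := hd0.norm.bddAbove_range
  have hCR' : ∀ n, ‖R n‖ ≤ CR := fun n => hCR ⟨n, rfl⟩
  have hCd' : ∀ n, ‖d n‖ ≤ Cd := fun n => hCd ⟨n, rfl⟩
  have hμd : ∀ n, μ n = d n + κ n • e := fun n => by simp [hd]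
  have hM0 : 0 ≤ M := (norm_nonneg _).trans (hvM 0)
  have hGR : ∀ n, ‖G (v n) - R n‖ ≤ CG + CR := fun n =>
    (norm_sub_le _ _).trans (add_le_add (hGM n) (hCR' n))
  have hGR0 : 0 ≤ CG + CR := (norm_nonneg _).trans (hGR 0)
  have hCd0 : 0 ≤ Cd := (norm_nonneg _).trans (hCd' 0)
  have hκb : ∀ n, |κ n| ≤ ‖fracPow lamB bB σ e‖ * ‖fracPow lamB bB σ (v n)‖ + (CG + CR) := by
    intro n
    have h2 := hweak n e he hebd
    rw [inner_sub_left] at h2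
    have h3 : κ n = ⟪fracPow lamB bB σ (v n), fracPow lamB bB σ e⟫ + ⟪G (v n) - R n, e⟫ := by
      simp only [hκ]; linarith
    rw [h3]
    refine (abs_add_le _ _).trans (add_le_add ?_ ?_)
    · rw [mul_comm]; exact abs_real_inner_le_norm _ _
    · refine (abs_real_inner_le_norm _ _).trans ?_
      rw [hen, mul_one]; exact hGR n
  have hBb : ∀ n, ‖fracPow lamB bB σ (v n)‖
      ≤ (2 * (CG + CR) + Cd) * M + ‖fracPow lamB bB σ e‖ * M + 1 := by
    intro n
    refine le_of_sq_le_add_mul (by positivity) (by positivity) ?_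
    have h2 := hweak n (v n) (hv n) (hvbd n)
    rw [real_inner_self_eq_norm_sq] at h2
    have h3 : ‖G (v n) - R n - μ n‖ ≤ (CG + CR) + (Cd + |κ n|) := by
      refine (norm_sub_le _ _).trans (add_le_add (hGR n) ?_)
      rw [hμd n]
      refine (norm_add_le _ _).trans (add_le_add (hCd' n) ?_)
      rw [norm_smul, hen, mul_one, Real.norm_eq_abs]
    have h4 := (abs_le.1 (abs_real_inner_le_norm (G (v n) - R n - μ n) (v n))).1
    have h5 : ‖G (v n) - R n - μ n‖ * ‖v n‖ ≤ ((CG + CR) + (Cd + |κ n|)) * M :=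
      mul_le_mul h3 (hvM n) (norm_nonneg _) ((norm_nonneg _).trans h3)
    have h6 := mul_le_mul_of_nonneg_right (hκb n) hM0
    nlinarith
  have hvw := tendsto_of_inner_basis hlamB hσ hv hw hBb hlim
  refine ⟨hvw, ?_⟩
  have hGw := (hG.tendsto w).comp hvw
  have hT : ∀ j, Tendsto (fun n => κ n * ⟪e, bB j⟫) atTop
      (𝓝 ((lamB j ^ σ) ^ 2 * ⟪w, bB j⟫ + ⟪G w - F, bB j⟫)) := by
    intro j
    have h2 : Tendsto (fun n => (lamB j ^ σ) ^ 2 * ⟪v n, bB j⟫ + ⟪G (v n) - R n - d n, bB j⟫)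
        atTop (𝓝 ((lamB j ^ σ) ^ 2 * ⟪w, bB j⟫ + ⟪G w - F - 0, bB j⟫)) :=
      ((hlim j).const_mul _).add (((hGw.sub hR).sub hd0).inner tendsto_const_nhds)
    rw [sub_zero] at h2
    refine h2.congr fun n => ?_
    have h3 := weak_eq_of_dense hdense (hweak n) (fracPow_basis j).1
    rw [inner_fracPow_basis (hv n) j, hμd n, ← sub_sub, inner_sub_left _ (κ n • e),
      real_inner_smul_left] at h3
    linarith
  obtain ⟨j0, hj0⟩ : ∃ j, ⟪e, bB j⟫ ≠ 0 := by
    by_contra! h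
    have : e = 0 := ext_inner_basis bB fun j => by rw [h j, inner_zero_left]
    rw [this, norm_zero] at hen
    exact zero_ne_one hen
  obtain ⟨κ0, hκlim⟩ : ∃ κ0, Tendsto κ atTop (𝓝 κ0) :=
    ⟨_, ((hT j0).div_const ⟪e, bB j0⟫).congr fun n => mul_div_cancel_right₀ _ hj0⟩
  refine ⟨κ0, fun j => ?_⟩
  have h2 := tendsto_nhds_unique (hT j) (hκlim.mul_const ⟪e, bB j⟫)
  rw [inner_sub_left, real_inner_smul_left]
  linarith

section Measurability

lemma aestronglyMeasurable_fracPow {Om : Set E3} {lam : ℕ → ℝ} {ρ : ℝ}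
    {b : HilbertBasis ℕ ℝ (Hs Om)} {ν : Measure ℝ} {f : ℝ → Hs Om}
    (hf : AEStronglyMeasurable f ν) (hdom : ∀ᵐ t ∂ν, inDom lam b ρ (f t)) :
    AEStronglyMeasurable (fun t => fracPow lam b ρ (f t)) ν := by
  refine aestronglyMeasurable_of_tendsto_ae atTop
    (f := fun n t => ∑ j ∈ Finset.range n, (lam j ^ ρ * ⟪f t, b j⟫) • b j) (fun n => ?_)
    (hdom.mono fun t ht => (hasSum_fracPow ht).tendsto_sum_nat)
  refine Finset.aestronglyMeasurable_fun_sum _ fun j _ => ?_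
  exact ((hf.inner aestronglyMeasurable_const).const_mul _).smul_const _

lemma intervalIntegrable_indicator_Ioi {V : Type*} [NormedAddCommGroup V] {f : ℝ → V}
    (hf : ∀ T : ℝ, 0 < T → IntegrableOn f (Ioc 0 T)) (a b : ℝ) :
    IntervalIntegrable ((Ioi 0).indicator f) volume a b := by
  set T := max (max a b) 1 with hT
  have h1 : Integrable ((Ioc 0 T).indicator f) :=
    (integrable_indicator_iff measurableSet_Ioc).2 (hf T (by positivity))
  refine (h1.intervalIntegrable (a := a) (b := b)).congr fun t ht => ?_
  have h2 : t ≤ T := by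
    have := (uIoc_subset_uIcc ht).2
    exact this.trans (le_max_left _ _)
  by_cases h0 : 0 < t
  · rw [indicator_of_mem (show t ∈ Ioc 0 T from ⟨h0, h2⟩), indicator_of_mem (mem_Ioi.2 h0)]
  · rw [indicator_of_notMem fun h => h0 h.1, indicator_of_notMem (notMem_Ioi.2 (not_lt.1 h0))]

lemma integrableOn_of_integrableOn_norm_sq {V : Type*} [NormedAddCommGroup V] {f : ℝ → V}
    (hf : AEStronglyMeasurable f (volume.restrict (Ioi 0))) {T : ℝ}
    (h2 : IntegrableOn (fun t => ‖f t‖ ^ 2) (Ioc 0 T)) : IntegrableOn f (Ioc 0 T) := by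
  have hm := hf.mono_measure (Measure.restrict_mono
    (Ioc_subset_Ioi_self : Ioc 0 T ⊆ Ioi 0) le_rfl)
  exact ((memLp_two_iff_integrable_sq_norm hm).2 h2).integrable (by norm_num)

end Measurability

section Bounds

variable {Om : Set E3} [IsFiniteMeasure (mOm Om)] {a b : ℝ}

lemma exists_norm_le_of_ae_mem_Icc (Om : Set E3) [IsFiniteMeasure (mOm Om)] (a b : ℝ) :
    ∃ M : ℝ, 0 ≤ M ∧ ∀ v : Hs Om, (∀ᵐ x ∂(mOm Om), v x ∈ Icc a b) → ‖v‖ ≤ M := by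
  refine ⟨_, ?_, fun v hv => Lp.norm_le_of_ae_bound (C := max |a| |b|) (by positivity) ?_⟩
  · positivity
  · exact hv.mono fun x hx => abs_le_max_abs_abs hx.1 hx.2

lemma norm_superpos_le {K : ℝ≥0} {k : ℝ → ℝ} (hk : LipschitzWith K k) (v : Hs Om) :
    ‖superpos k hk v‖ ≤ ‖superpos k hk (0 : Hs Om)‖ + K * ‖v‖ := by
  have h := (lipschitzWith_superpos (Om := Om) hk).dist_le_mul v 0
  rw [dist_eq_norm, dist_zero_right] at h
  have := norm_le_norm_add_norm_sub' (superpos k hk v) (superpos k hk 0)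
  linarith

lemma total_potential_sub_le {betah : ℝ → ℝ≥0∞} {Bd : ℝ} {pih piF k : ℝ → ℝ} {Lpi K : ℝ≥0}
    (hlsc : LowerSemicontinuous betah) (hbd : ∀ s ∈ Icc a b, betah s ≤ ENNReal.ofReal Bd)
    (hd : ∀ s, HasDerivAt pih (piF s) s) (hL : LipschitzWith Lpi piF)
    (hk : LipschitzWith K k) (hbk : EqOn (fun s => (betah s).toReal + pih s) k (Icc a b))
    {v w : Hs Om} (hv : ∀ᵐ x ∂(mOm Om), v x ∈ Icc a b) (hw : ∀ᵐ x ∂(mOm Om), w x ∈ Icc a b) :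
    ⟪superpos k hk v, Lp.const 2 (mOm Om) (1 : ℝ)⟫
        - ⟪superpos k hk w, Lp.const 2 (mOm Om) (1 : ℝ)⟫
      ≤ (∫⁻ x, betah (v x) ∂(mOm Om)).toReal - (∫⁻ x, betah (w x) ∂(mOm Om)).toReal
        + ⟪superpos piF hL v, v - w⟫ + Lpi * ‖v - w‖ ^ 2 := by
  obtain ⟨i1, e1⟩ := toReal_lintegral_comp hlsc hbd hv
  obtain ⟨i2, e2⟩ := toReal_lintegral_comp hlsc hbd hw
  have i3 := integrable_mul (superpos piF hL v) (v - w)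
  have i4 := integrable_mul (v - w) (v - w)
  have i5 := (memLp_comp_lipschitz hk v).integrable (by norm_num)
  have i6 := (memLp_comp_lipschitz hk w).integrable (by norm_num)
  have i7 : Integrable (fun x => (betah (v x)).toReal - (betah (w x)).toReal) (mOm Om) :=
    i1.sub i2
  have i8 : Integrable (fun x => (betah (v x)).toReal - (betah (w x)).toReal
    + superpos piF hL v x * (v - w) x) (mOm Om) := i7.add i3
  rw [← integral_superpos, ← integral_superpos, e1, e2, ← integral_sub i1 i2, ← integral_sub i5 i6,
    ← real_inner_self_eq_norm_sq, inner_eq_integral, inner_eq_integral, ← integral_const_mul,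
    ← integral_add i7 i3, ← integral_add i8 (i4.const_mul _)]
  refine integral_mono_ae (i5.sub i6) (i8.add (i4.const_mul _)) ?_
  filter_upwards [hv, hw, Lp.coeFn_sub v w, coeFn_superpos hL v] with x h1 h2 h3 h4
  simp only [h3, h4, Pi.sub_apply, ← hbk h1, ← hbk h2]
  have := primitive_sub_le hd hL (v x) (w x)
  linarith

end Bounds

section Increments

variable {V : Type*} [NormedAddCommGroup V] [InnerProductSpace ℝ V] [CompleteSpace V]

lemma inner_intervalIntegral {f : ℝ → V} {s t : ℝ} (hf : IntervalIntegrable f volume s t) (x : V) :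
    ⟪∫ r in s..t, f r, x⟫ = ∫ r in s..t, ⟪f r, x⟫ := by
  have h := (innerSL ℝ x).intervalIntegral_comp_comm hf
  simp only [innerSL_apply_apply] at h
  rw [real_inner_comm, ← h]
  simp only [real_inner_comm]

lemma inner_increment {y f : ℝ → V} {v w : V} {c : ℝ} {D : ℝ → ℝ}
    (hf : ∀ a b, IntervalIntegrable f volume a b)
    (hy : ∀ t : ℝ, 0 ≤ t → ⟪y t, v⟫ = ⟪y 0, v⟫ + ∫ s in (0:ℝ)..t, D s)
    (hD : ∀ᵐ t ∂(volume.restrict (Ioi (0:ℝ))), ⟪f t, w⟫ = c * D t)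
    {s t : ℝ} (hs : 0 ≤ s) (ht : 0 ≤ t) :
    c * ⟪y t - y s, v⟫ = ⟪∫ r in s..t, f r, w⟫ := by
  have h1 : ∀ T, 0 ≤ T → c * ∫ s in (0:ℝ)..T, D s = ⟪∫ r in (0:ℝ)..T, f r, w⟫ := by
    intro T hT
    rw [inner_intervalIntegral (hf _ _), ← intervalIntegral.integral_const_mul]
    refine intervalIntegral.integral_congr_ae ?_
    filter_upwards [(ae_restrict_iff' measurableSet_Ioi).1 hD] with r hr hr'
    rw [uIoc_of_le hT] at hr'
    exact (hr hr'.1).symm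
  rw [inner_sub_left, hy t ht, hy s hs,
    ← intervalIntegral.integral_interval_sub_left (hf 0 t) (hf 0 s),
    inner_sub_left, ← h1 t ht, ← h1 s hs]
  ring

end Increments

lemma energy_increment_le {Om : Set E3} [IsFiniteMeasure (mOm Om)] {a b : ℝ}
    {betah : ℝ → ℝ≥0∞} {Bd : ℝ} {pih piF k : ℝ → ℝ} {Lpi K : ℝ≥0}
    {lamA lamB : ℕ → ℝ} {r σ : ℝ} {bA bB : HilbertBasis ℕ ℝ (Hs Om)}
    (hlsc : LowerSemicontinuous betah) (hbd : ∀ s ∈ Icc a b, betah s ≤ ENNReal.ofReal Bd)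
    (hd : ∀ s, HasDerivAt pih (piF s) s) (hL : LipschitzWith Lpi piF)
    (hk : LipschitzWith K k) (hbk : EqOn (fun s => (betah s).toReal + pih s) k (Icc a b))
    {v w f z μ J : Hs Om} {C : ℝ}
    (hv : ∀ᵐ x ∂(mOm Om), v x ∈ Icc a b) (hw : ∀ᵐ x ∂(mOm Om), w x ∈ Icc a b)
    (hvB : inDom lamB bB σ v) (hwB : inDom lamB bB σ w) (hμ : inDom lamA bA r μ)
    (hJ : ∀ φ, inDom lamA bA r φ → ⟪v - w, φ⟫ = -⟪J, fracPow lamA bA r φ⟫)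
    (hehr : 2 * Lpi * ‖v - w‖ ^ 2 ≤ ‖fracPow lamB bB σ (v - w)‖ ^ 2 + C * ‖J‖ ^ 2)
    (hineq : ⟪z, v - w⟫ + ⟪fracPow lamB bB σ v, fracPow lamB bB σ v - fracPow lamB bB σ w⟫
      + (∫⁻ x, betah (v x) ∂(mOm Om)).toReal + ∫ x, (piF (v x) - f x) * (v x - w x) ∂(mOm Om)
      ≤ ⟪μ, v - w⟫ + (∫⁻ x, betah (w x) ∂(mOm Om)).toReal) :
    (‖fracPow lamB bB σ v‖ ^ 2 / 2 + ⟪superpos k hk v, Lp.const 2 (mOm Om) (1 : ℝ)⟫)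
        - (‖fracPow lamB bB σ w‖ ^ 2 / 2 + ⟪superpos k hk w, Lp.const 2 (mOm Om) (1 : ℝ)⟫)
      ≤ -⟪fracPow lamA bA r μ, J⟫ - ⟪z, v - w⟫ + ⟪f, v - w⟫ + C / 2 * ‖J‖ ^ 2 := by
  have h1 := total_potential_sub_le hlsc hbd hd hL hk hbk hv hw
  rw [integral_sub_mul_sub hL v f v w, inner_sub_left, real_inner_comm _ μ, hJ μ hμ,
    real_inner_comm _ J] at hineq
  have h2 : ⟪fracPow lamB bB σ v, fracPow lamB bB σ v - fracPow lamB bB σ w⟫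
      = ‖fracPow lamB bB σ v‖ ^ 2 / 2 - ‖fracPow lamB bB σ w‖ ^ 2 / 2
        + ‖fracPow lamB bB σ (v - w)‖ ^ 2 / 2 := by
    rw [(fracPow_sub hvB hwB).2, inner_sub_right, real_inner_self_eq_norm_sq,
      norm_sub_sq_real]
    ring
  linarith

section Dissipation

variable {V W : Type*} [NormedAddCommGroup V] [InnerProductSpace ℝ V] [CompleteSpace V]
  [NormedAddCommGroup W] [InnerProductSpace ℝ W] [CompleteSpace W]

/-- The abstract energy estimate for a pair of gradient terms. -/
lemma integral_add_norm_sq_le_of_energy {m : ℝ → V} {z : ℝ → W} {E : ℝ → ℝ} {P : ℝ → Prop}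
    {K C1 C : ℝ}
    (hm : ∀ a b, IntervalIntegrable m volume a b)
    (hm2 : ∀ a b, IntervalIntegrable (fun r => ‖m r‖ ^ 2) volume a b)
    (hz : ∀ a b, IntervalIntegrable z volume a b)
    (hz2 : ∀ a b, IntervalIntegrable (fun r => ‖z r‖ ^ 2) volume a b)
    (hE : ∀ a b, IntervalIntegrable E volume a b)
    (hlow : ∀ᵐ t, 0 < t → -K ≤ E t)
    (hup : ∀ᵐ t, 0 < t → t ≤ 1 → E t ≤ C1)
    (hP : ∀ᵐ t, 0 < t → P t) (hC : 0 ≤ C)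
    (hineq : ∀ s t, 0 < s → s < t → P s → P t →
      E t - E s ≤ -⟪m t, ∫ r in s..t, m r⟫ - ⟪z t, ∫ r in s..t, z r⟫
        + C * ‖∫ r in s..t, m r‖ ^ 2)
    {T : ℝ} (hT : 1 ≤ T) : ∫ t in (1:ℝ)..T, (‖m t‖ ^ 2 + ‖z t‖ ^ 2) ≤ K + C1 := by
  set X : ℝ → WithLp 2 (V × W) := fun t => WithLp.toLp 2 (m t, z t) with hX
  have hXn : ∀ t, ‖X t‖ ^ 2 = ‖m t‖ ^ 2 + ‖z t‖ ^ 2 := fun t =>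
    WithLp.prod_norm_sq_eq_of_L2 (X t)
  have hXi : ∀ a b, IntervalIntegrable X volume a b := fun a b => by
    set ι := (WithLp.prodContinuousLinearEquiv 2 ℝ V W).symm.toContinuousLinearMap
    exact ⟨ι.integrable_comp ((hm a b).1.prodMk (hz a b).1),
      ι.integrable_comp ((hm a b).2.prodMk (hz a b).2)⟩
  have hint : ∀ s t, ∫ r in s..t, X r = WithLp.toLp 2 (∫ r in s..t, m r, ∫ r in s..t, z r) := by
    intro s t
    have h1 : (∫ r in s..t, X r).fst = ∫ r in s..t, m r :=
      ((WithLp.fstL 2 ℝ V W).intervalIntegral_comp_comm (hXi s t)).symm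
    have h2 : (∫ r in s..t, X r).snd = ∫ r in s..t, z r :=
      ((WithLp.sndL 2 ℝ V W).intervalIntegral_comp_comm (hXi s t)).symm
    rw [← h1, ← h2]
    rfl
  have := integral_norm_sq_le_of_energy hXi
    (by simpa only [hXn] using fun a b => (hm2 a b).add (hz2 a b))
    hE hlow hup hP hC (fun s t hs hst h1 h2 => ?_) hT
  · simpa only [hXn] using this
  · refine (hineq s t hs hst h1 h2).trans ?_
    have h3 : ‖∫ r in s..t, X r‖ ^ 2 = ‖∫ r in s..t, m r‖ ^ 2 + ‖∫ r in s..t, z r‖ ^ 2 := by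
      rw [hint]
      exact WithLp.prod_norm_sq_eq_of_L2 _
    rw [h3, hint, WithLp.prod_inner_apply]
    have := mul_nonneg hC (sq_nonneg ‖∫ r in s..t, z r‖)
    simp only [hX]
    linarith

end Dissipation

lemma exists_variation_bound {V : Type*} [NormedAddCommGroup V] [NormedSpace ℝ V] [CompleteSpace V]
    {u u' : ℝ → V} (hu' : IntegrableOn u' (Ioi (0:ℝ)))
    (hu : ∀ t : ℝ, 0 ≤ t → u t = u 0 + ∫ s in (0:ℝ)..t, u' s) :
    ∃ (N : ℝ → ℝ) (N1 : ℝ), Continuous N ∧ (∀ t, 0 ≤ t → 0 ≤ N t ∧ N t ≤ N1) ∧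
      (∀ s t, 0 ≤ s → s ≤ t → ‖u t - u s‖ ≤ N t - N s) ∧ (∀ t, 0 ≤ t → ‖u t‖ ≤ ‖u 0‖ + N1) ∧
      AEStronglyMeasurable u (volume.restrict (Ioi 0)) := by
  set v := (Ioi (0:ℝ)).indicator u' with hv
  have hvi : Integrable v := (integrable_indicator_iff measurableSet_Ioi).2 hu'
  have hvI : ∀ s t, IntervalIntegrable v volume s t := fun s t => hvi.intervalIntegrable
  have huv : ∀ t, 0 ≤ t → u t = u 0 + ∫ s in (0:ℝ)..t, v s := fun t ht => by
    rw [hu t ht]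
    congr 1
    refine intervalIntegral.integral_congr_ae (Eventually.of_forall fun s hs => ?_)
    rw [uIoc_of_le ht] at hs
    exact (indicator_of_mem (mem_Ioi.2 hs.1) u').symm
  set N : ℝ → ℝ := fun t => ∫ s in (0:ℝ)..t, ‖v s‖ with hN
  have hNsub : ∀ s t, N t - N s = ∫ r in s..t, ‖v r‖ := fun s t =>
    intervalIntegral.integral_interval_sub_left (hvI 0 t).norm (hvI 0 s).norm
  have hvar : ∀ s t, 0 ≤ s → s ≤ t → ‖u t - u s‖ ≤ N t - N s := fun s t hs hst => by
    rw [huv t (hs.trans hst), huv s hs, hNsub, add_sub_add_left_eq_sub,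
      intervalIntegral.integral_interval_sub_left (hvI 0 t) (hvI 0 s)]
    exact intervalIntegral.norm_integral_le_integral_norm hst
  have hN0 : N 0 = 0 := by simp [hN]
  have hNb : ∀ t, 0 ≤ t → 0 ≤ N t ∧ N t ≤ ∫ s, ‖v s‖ := fun t ht => by
    refine ⟨intervalIntegral.integral_nonneg ht fun s _ => norm_nonneg _, ?_⟩
    simp only [hN]
    rw [intervalIntegral.integral_of_le ht]
    exact setIntegral_le_integral hvi.norm (Eventually.of_forall fun s => norm_nonneg _)
  refine ⟨N, _, intervalIntegral.continuous_primitive (fun s t => (hvI s t).norm) 0, hNb, hvar,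
    fun t ht => ?_, ?_⟩
  · have h1 := hvar 0 t le_rfl ht
    have h2 := norm_le_norm_add_norm_sub' (u t) (u 0)
    linarith [(hNb t ht).2]
  · have hc : Continuous fun t => u 0 + ∫ s in (0:ℝ)..t, v s :=
      continuous_const.add (intervalIntegral.continuous_primitive hvI 0)
    refine hc.aestronglyMeasurable.congr ?_
    filter_upwards [ae_restrict_mem measurableSet_Ioi] with t ht
    exact (huv t (mem_Ioi.1 ht).le).symm

section Solution

variable {Om : Set E3} {lamA lamB : ℕ → ℝ} {bA bB : HilbertBasis ℕ ℝ (Hs Om)} {r σ τ : ℝ}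
  {betah : ℝ → ℝ≥0∞} {piF : ℝ → ℝ} {u : ℝ → Hs Om} {y0 : Hs Om} {y μ : ℝ → Hs Om}
  {dy : ℝ → Hs Om →ₗ[ℝ] ℝ} {z : ℝ → Hs Om}

lemma norm_indicator_sq {V : Type*} [NormedAddCommGroup V] (f : ℝ → V) (t : ℝ) :
    ‖(Ioi (0:ℝ)).indicator f t‖ ^ 2 = (Ioi (0:ℝ)).indicator (fun t => ‖f t‖ ^ 2) t := by
  by_cases h : t ∈ Ioi (0:ℝ) <;> simp [indicator, h]

/-- The gradient of the chemical potential, extended by zero to negative times. -/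
def gradPot (lamA : ℕ → ℝ) (bA : HilbertBasis ℕ ℝ (Hs Om)) (r : ℝ) (μ : ℝ → Hs Om) :
    ℝ → Hs Om :=
  (Ioi (0:ℝ)).indicator fun t => fracPow lamA bA r (μ t)

lemma IsSolution.aestronglyMeasurable_fracPow_pot
    (hsol : IsSolution Om lamA lamB bA bB r σ τ betah piF u y0 y μ dy z) :
    AEStronglyMeasurable (fun t => fracPow lamA bA r (μ t)) (volume.restrict (Ioi (0:ℝ))) := by
  obtain ⟨-, -, -, -, -, -, -, -, -, hμm, hμd, -⟩ := hsol
  exact aestronglyMeasurable_fracPow hμm hμd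

lemma IsSolution.integrableOn_fracPow_pot
    (hsol : IsSolution Om lamA lamB bA bB r σ τ betah piF u y0 y μ dy z) {T : ℝ} (hT : 0 < T) :
    IntegrableOn (fun t => ‖fracPow lamA bA r (μ t)‖ ^ 2) (Ioc 0 T) := by
  have hm := hsol.aestronglyMeasurable_fracPow_pot
  obtain ⟨-, -, -, -, -, -, -, -, -, -, -, hμi, -⟩ := hsol
  refine (hμi T hT).mono' ?_ (Eventually.of_forall fun t => ?_)
  · exact ((hm.mono_measure (Measure.restrict_mono (Ioc_subset_Ioi_self : Ioc 0 T ⊆ Ioi 0)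
      le_rfl)).norm.pow 2)
  · rw [Real.norm_eq_abs, abs_of_nonneg (sq_nonneg _), gnormSq]
    exact le_add_of_nonneg_left (sq_nonneg _)

lemma IsSolution.intervalIntegrable_gradPot
    (hsol : IsSolution Om lamA lamB bA bB r σ τ betah piF u y0 y μ dy z) (s t : ℝ) :
    IntervalIntegrable (gradPot lamA bA r μ) volume s t :=
  intervalIntegrable_indicator_Ioi (fun _ hT => integrableOn_of_integrableOn_norm_sq
    hsol.aestronglyMeasurable_fracPow_pot (hsol.integrableOn_fracPow_pot hT)) s t

lemma IsSolution.intervalIntegrable_gradPot_sq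
    (hsol : IsSolution Om lamA lamB bA bB r σ τ betah piF u y0 y μ dy z) (s t : ℝ) :
    IntervalIntegrable (fun t => ‖gradPot lamA bA r μ t‖ ^ 2) volume s t := by
  simp only [gradPot, norm_indicator_sq]
  exact intervalIntegrable_indicator_Ioi (fun _ hT => hsol.integrableOn_fracPow_pot hT) s t

lemma IsSolution.intervalIntegrable_rate
    (hsol : IsSolution Om lamA lamB bA bB r σ τ betah piF u y0 y μ dy z) (s t : ℝ) :
    IntervalIntegrable ((Ioi (0:ℝ)).indicator z) volume s t := by
  obtain ⟨-, -, -, -, -, -, hzm, -, hzi, -⟩ := hsol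
  exact intervalIntegrable_indicator_Ioi (fun T hT => integrableOn_of_integrableOn_norm_sq
    hzm (hzi T hT)) s t

lemma IsSolution.intervalIntegrable_rate_sq
    (hsol : IsSolution Om lamA lamB bA bB r σ τ betah piF u y0 y μ dy z) (s t : ℝ) :
    IntervalIntegrable (fun t => ‖(Ioi (0:ℝ)).indicator z t‖ ^ 2) volume s t := by
  obtain ⟨-, -, -, -, -, -, -, -, hzi, -⟩ := hsol
  simp only [norm_indicator_sq]
  exact intervalIntegrable_indicator_Ioi hzi s t

lemma IsSolution.inner_increment_eq
    (hsol : IsSolution Om lamA lamB bA bB r σ τ betah piF u y0 y μ dy z) {s t : ℝ} (hs : 0 ≤ s)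
    (ht : 0 ≤ t) {v : Hs Om} (hv : inDom lamA bA r v) :
    ⟪y t - y s, v⟫ = -⟪∫ q in s..t, gradPot lamA bA r μ q, fracPow lamA bA r v⟫ := by
  have hi := hsol.intervalIntegrable_gradPot
  obtain ⟨-, -, -, -, hdy, -, -, -, -, -, -, -, -, heq, -⟩ := hsol
  have h1 := inner_increment (c := -1) hi (hdy v hv) (w := fracPow lamA bA r v) (by
    filter_upwards [heq, ae_restrict_mem measurableSet_Ioi] with q hq hq0
    rw [gradPot, indicator_of_mem hq0]
    linarith [hq v hv]) hs ht
  linarith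

lemma IsSolution.smul_increment_eq
    (hsol : IsSolution Om lamA lamB bA bB r σ τ betah piF u y0 y μ dy z) {s t : ℝ} (hs : 0 ≤ s)
    (ht : 0 ≤ t) : τ • (y t - y s) = ∫ q in s..t, (Ioi (0:ℝ)).indicator z q := by
  have hi := hsol.intervalIntegrable_rate
  obtain ⟨-, -, -, -, hdy, -, -, hz, -⟩ := hsol
  refine ext_inner_basis bA fun j => ?_
  rw [real_inner_smul_left]
  have hj : inDom lamA bA r (bA j) := (fracPow_basis j).1
  refine inner_increment hi (hdy _ hj) ?_ hs ht
  filter_upwards [hz, ae_restrict_mem measurableSet_Ioi] with q hq hq0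
  rw [indicator_of_mem hq0, hq _ hj]

lemma IsSolution.rate_eq_zero
    (hsol : IsSolution Om lamA lamB bA bB r σ τ betah piF u y0 y μ dy z) (hτ : τ = 0) :
    ∀ᵐ t ∂(volume.restrict (Ioi (0:ℝ))), z t = 0 := by
  obtain ⟨-, -, -, -, -, -, -, hz, -⟩ := hsol
  filter_upwards [hz] with t ht
  refine ext_inner_basis bA fun j => ?_
  rw [ht _ (fracPow_basis j).1, hτ, zero_mul, inner_zero_left]

end Solution

section Solution

variable {Om : Set E3} {lamA lamB : ℕ → ℝ} {bA bB : HilbertBasis ℕ ℝ (Hs Om)} {r σ τ : ℝ}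
  {betah : ℝ → ℝ≥0∞} {piF : ℝ → ℝ} {u : ℝ → Hs Om} {y0 : Hs Om} {y μ : ℝ → Hs Om}
  {dy : ℝ → Hs Om →ₗ[ℝ] ℝ} {z : ℝ → Hs Om}

/-- The dissipation of a solution with values in a compact interval is integrable. -/
theorem IsSolution.integrableOn_dissipation [IsFiniteMeasure (mOm Om)] {a b : ℝ} {Bd : ℝ}
    {pih k : ℝ → ℝ} {Lpi K : ℝ≥0} {u' : ℝ → Hs Om}
    (hsol : IsSolution Om lamA lamB bA bB r σ τ betah piF u y0 y μ dy z)
    (hlamB : Tendsto lamB atTop atTop) (hσ : 0 < σ) (hτ : τ ∈ Icc (0:ℝ) 1)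
    (hlsc : LowerSemicontinuous betah) (hbd : ∀ s ∈ Icc a b, betah s ≤ ENNReal.ofReal Bd)
    (hd : ∀ s, HasDerivAt pih (piF s) s) (hL : LipschitzWith Lpi piF)
    (hk : LipschitzWith K k) (hbk : EqOn (fun s => (betah s).toReal + pih s) k (Icc a b))
    (hu' : IntegrableOn u' (Ioi (0:ℝ)))
    (hu : ∀ t : ℝ, 0 ≤ t → u t = u 0 + ∫ s in (0:ℝ)..t, u' s)
    (hyab : ∀ᵐ t ∂(volume.restrict (Ioi (0:ℝ))), ∀ᵐ x ∂(mOm Om), y t x ∈ Icc a b) :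
    IntegrableOn (fun t => ‖fracPow lamA bA r (μ t)‖ ^ 2) (Ioi 1) ∧
      IntegrableOn (fun t => ‖z t‖ ^ 2) (Ioi 1) := by
  obtain ⟨M, hM0, hM⟩ := exists_norm_le_of_ae_mem_Icc Om a b
  obtain ⟨N, N1, hNc, hNb, hvar, hub, hum⟩ := exists_variation_bound hu' hu
  obtain ⟨C, hC, hehr⟩ := exists_ehrling (lamA := lamA) (r := r) (bA := bA) (b := bB) hlamB hσ
    (K := 2 * Lpi) (by positivity)
  have hinc := fun s t (hs : 0 ≤ s) (ht : 0 ≤ t) v hv =>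
    hsol.inner_increment_eq (s := s) (t := t) hs ht (v := v) hv
  have hzinc := fun s t (hs : 0 ≤ s) (ht : 0 ≤ t) => hsol.smul_increment_eq (s := s) (t := t) hs ht
  have hz0 : ∀ᵐ t ∂(volume.restrict (Ioi (0:ℝ))), τ = 0 → z t = 0 := by
    by_cases h : τ = 0
    · exact (hsol.rate_eq_zero h).mono fun t ht _ => ht
    · exact Eventually.of_forall fun t h' => absurd h' h
  have hm := hsol.intervalIntegrable_gradPot
  have hm2 := hsol.intervalIntegrable_gradPot_sq
  have hzi := hsol.intervalIntegrable_rate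
  have hzi2 := hsol.intervalIntegrable_rate_sq
  have hmm := hsol.aestronglyMeasurable_fracPow_pot
  obtain ⟨hym, hyd, hyC, -, -, -, hzm, -, -, -, hμd, -, -, -, hineq, -⟩ := hsol
  set one : Hs Om := Lp.const 2 (mOm Om) (1 : ℝ) with hone
  set m := gradPot lamA bA r μ with hm_def
  set c : ℝ := (√τ)⁻¹ with hc
  set Z : ℝ → Hs Om := fun t => c • (Ioi (0:ℝ)).indicator z t with hZ
  set Φ : ℝ → ℝ := fun t => ‖fracPow lamB bB σ (y t)‖ ^ 2 / 2 + ⟪superpos k hk (y t), one⟫ with hΦ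
  set E0 : ℝ → ℝ := fun t => Φ t - ⟪u t, y t⟫ - M * N t with hE0
  set E : ℝ → ℝ := (Ioi (0:ℝ)).indicator E0 with hE
  set P : ℝ → Prop := fun t => inDom lamB bB σ (y t) ∧ (∀ᵐ x ∂(mOm Om), y t x ∈ Icc a b) ∧
    inDom lamA bA r (μ t) ∧ (τ = 0 → z t = 0) ∧ ∀ v : Hs Om,
    inDom lamB bB σ v → (∫⁻ x, betah (v x) ∂(mOm Om)) < ⊤ →
    ⟪z t, y t - v⟫
      + ⟪fracPow lamB bB σ (y t), fracPow lamB bB σ (y t) - fracPow lamB bB σ v⟫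
      + (∫⁻ x, betah (y t x) ∂(mOm Om)).toReal
      + ∫ x, (piF (y t x) - u t x) * (y t x - v x) ∂(mOm Om)
      ≤ ⟪μ t, y t - v⟫ + (∫⁻ x, betah (v x) ∂(mOm Om)).toReal with hP_def
  have hP' : ∀ᵐ t ∂(volume.restrict (Ioi (0:ℝ))), P t := by
    filter_upwards [hyd, hyab, hμd, hz0, hineq] with t h1 h2 h3 h4 h5
    exact ⟨h1, h2, h3, h4, h5⟩
  have hP : ∀ᵐ t, 0 < t → P t := (ae_restrict_iff' measurableSet_Ioi).1 hP'
  set S : ℝ := (‖superpos k hk (0 : Hs Om)‖ + K * M) * ‖one‖ with hS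
  set R : ℝ := S + (‖u 0‖ + N1) * M + M * N1 with hR
  have hbound : ∀ t, 0 < t → P t →
      |E0 t - ‖fracPow lamB bB σ (y t)‖ ^ 2 / 2| ≤ R := by
    intro t ht hPt
    have h1 : |⟪superpos k hk (y t), one⟫| ≤ S := by
      refine (abs_real_inner_le_norm _ _).trans ?_
      refine mul_le_mul_of_nonneg_right ((norm_superpos_le hk _).trans ?_) (norm_nonneg _)
      gcongr
      exact hM _ hPt.2.1
    have h2 : |⟪u t, y t⟫| ≤ (‖u 0‖ + N1) * M := by
      refine (abs_real_inner_le_norm _ _).trans ?_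
      exact mul_le_mul (hub t ht.le) (hM _ hPt.2.1) (norm_nonneg _)
        ((norm_nonneg _).trans (hub t ht.le))
    have h3 : |M * N t| ≤ M * N1 := by
      rw [abs_of_nonneg (mul_nonneg hM0 (hNb t ht.le).1)]
      exact mul_le_mul_of_nonneg_left (hNb t ht.le).2 hM0
    have h4 : E0 t - ‖fracPow lamB bB σ (y t)‖ ^ 2 / 2
        = ⟪superpos k hk (y t), one⟫ - ⟪u t, y t⟫ - M * N t := by
      simp only [hE0, hΦ]; ring
    rw [h4, hR]
    have h1' := abs_le.1 h1
    have h2' := abs_le.1 h2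
    have h3' := abs_le.1 h3
    exact abs_le.2 ⟨by linarith, by linarith⟩
  have hlow : ∀ᵐ t, 0 < t → -R ≤ E t := by
    filter_upwards [hP] with t ht ht0
    rw [hE, indicator_of_mem (mem_Ioi.2 ht0)]
    have := (abs_le.1 (hbound t ht0 (ht ht0))).1
    have := sq_nonneg ‖fracPow lamB bB σ (y t)‖
    linarith
  have hupper : ∀ T, 0 < T → ∃ C1, ∀ᵐ t ∂(volume.restrict (Ioc 0 T)), |E0 t| ≤ C1 := by
    intro T hT
    obtain ⟨D, hD⟩ := hyC T hT
    refine ⟨D / 2 + R, ?_⟩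
    filter_upwards [hD, ae_restrict_of_ae hP, ae_restrict_mem measurableSet_Ioc] with t h1 h2 h3
    have h4 := abs_le.1 (hbound t h3.1 (h2 h3.1))
    simp only [gnormSq] at h1
    have h5 := sq_nonneg ‖y t‖
    have h6 := sq_nonneg ‖fracPow lamB bB σ (y t)‖
    exact abs_le.2 ⟨by linarith, by linarith⟩
  obtain ⟨C1, hC1⟩ := hupper 1 one_pos
  have hup : ∀ᵐ t, 0 < t → t ≤ 1 → E t ≤ C1 := by
    filter_upwards [(ae_restrict_iff' measurableSet_Ioc).1 hC1] with t ht h0 h1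
    rw [hE, indicator_of_mem (mem_Ioi.2 h0)]
    exact (abs_le.1 (ht ⟨h0, h1⟩)).2
  have hE0m : AEStronglyMeasurable E0 (volume.restrict (Ioi (0:ℝ))) := by
    have h1 := aestronglyMeasurable_fracPow hym hyd
    have h2 := (lipschitzWith_superpos (Om := Om) hk).continuous.comp_aestronglyMeasurable hym
    have h3 : AEStronglyMeasurable (fun t => ‖fracPow lamB bB σ (y t)‖ ^ 2 / 2)
        (volume.restrict (Ioi (0:ℝ))) := by
      simpa only [div_eq_mul_inv, Pi.pow_apply] using (h1.norm.pow 2).mul_const (2⁻¹ : ℝ)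
    exact ((h3.add (h2.inner aestronglyMeasurable_const)).sub
      (hum.inner hym)).sub (hNc.aestronglyMeasurable.const_mul M)
  have hEi : ∀ s t, IntervalIntegrable E volume s t :=
    intervalIntegrable_indicator_Ioi fun T hT => by
      obtain ⟨D, hD⟩ := hupper T hT
      exact (integrable_const D).mono'
        (hE0m.mono_measure (Measure.restrict_mono (Ioc_subset_Ioi_self : Ioc 0 T ⊆ Ioi 0) le_rfl))
        hD
  have hZi : ∀ s t, IntervalIntegrable Z volume s t := fun s t => (hzi s t).smul c
  have hZn : ∀ t, ‖Z t‖ ^ 2 = c ^ 2 * ‖(Ioi (0:ℝ)).indicator z t‖ ^ 2 := fun t => by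
    simp only [hZ]
    rw [norm_smul, mul_pow, Real.norm_eq_abs, sq_abs]
  have hZi2 : ∀ s t, IntervalIntegrable (fun t => ‖Z t‖ ^ 2) volume s t := fun s t => by
    simp only [hZn]
    exact (hzi2 s t).const_mul _
  have hstep : ∀ s t, 0 < s → s < t → P s → P t →
      E t - E s ≤ -⟪m t, ∫ q in s..t, m q⟫ - ⟪Z t, ∫ q in s..t, Z q⟫
        + C / 2 * ‖∫ q in s..t, m q‖ ^ 2 := by
    intro s t hs hst hPs hPt
    have ht : 0 < t := hs.trans hst
    have h1 := energy_increment_le hlsc hbd hd hL hk hbk (f := u t) (z := z t)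
      hPt.2.1 hPs.2.1 hPt.1 hPs.1 hPt.2.2.1 (hinc s t hs.le ht.le)
      (hehr _ _ (fracPow_sub hPt.1 hPs.1).1 (hinc s t hs.le ht.le))
      (hPt.2.2.2.2 _ hPs.1 (lintegral_comp_lt_top hbd hPs.2.1))
    have h2 : ⟪Z t, ∫ q in s..t, Z q⟫ = ⟪z t, y t - y s⟫ := by
      simp only [hZ]
      rw [intervalIntegral.integral_smul, ← hzinc s t hs.le ht.le,
        indicator_of_mem (mem_Ioi.2 ht), smul_smul, real_inner_smul_left, real_inner_smul_right]
      rcases eq_or_lt_of_le hτ.1 with h | h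
      · rw [hPt.2.2.2.1 h.symm]; simp
      · have : c * (c * τ) = 1 := by
          have h3 : √τ ≠ 0 := (Real.sqrt_pos.2 h).ne'
          rw [hc, ← Real.mul_self_sqrt h.le]
          rw [Real.sqrt_mul_self (Real.sqrt_nonneg τ)]
          field_simp
        rw [← mul_assoc, this, one_mul]
    have h3 : m t = fracPow lamA bA r (μ t) := indicator_of_mem (mem_Ioi.2 ht) _
    have h4 : ⟪u t, y t - y s⟫ - ⟪u t, y t⟫ + ⟪u s, y s⟫ ≤ M * (N t - N s) := by
      have h5 : ⟪u t, y t - y s⟫ - ⟪u t, y t⟫ + ⟪u s, y s⟫ = -⟪u t - u s, y s⟫ := by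
        rw [inner_sub_right, inner_sub_left]; ring
      rw [h5, mul_comm]
      refine (neg_le_abs _).trans ((abs_real_inner_le_norm _ _).trans ?_)
      exact mul_le_mul (hvar s t hs.le hst.le) (hM _ hPs.2.1) (norm_nonneg _)
        ((norm_nonneg _).trans (hvar s t hs.le hst.le))
    rw [h2, h3, hE, indicator_of_mem (mem_Ioi.2 ht), indicator_of_mem (mem_Ioi.2 hs)]
    simp only [hE0, hΦ]
    linarith
  have hfin := fun T (hT : 1 ≤ T) => integral_add_norm_sq_le_of_energy hm hm2 hZi hZi2 hEi hlow hup
    hP (by positivity) hstep hT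
  have hsum : IntegrableOn (fun t => ‖m t‖ ^ 2 + ‖Z t‖ ^ 2) (Ioi 1) := by
    refine integrableOn_Ioi_of_intervalIntegral_norm_bounded (R + C1) 1 (b := fun T : ℝ => T)
      (l := atTop) (fun T => ((hm2 1 T).add (hZi2 1 T)).1) tendsto_id ?_
    filter_upwards [eventually_ge_atTop 1] with T hT
    refine le_trans (le_of_eq ?_) (hfin T hT)
    refine intervalIntegral.integral_congr fun t _ => ?_
    exact abs_of_nonneg (by positivity)
  have hsub : Ioi (1:ℝ) ⊆ Ioi 0 := Ioi_subset_Ioi zero_le_one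
  refine ⟨hsum.mono' ((hmm.mono_measure (Measure.restrict_mono hsub le_rfl)).norm.pow 2) ?_,
    hsum.mono' ((hzm.mono_measure (Measure.restrict_mono hsub le_rfl)).norm.pow 2) ?_⟩
  · filter_upwards [ae_restrict_mem measurableSet_Ioi] with t ht
    have h1 : m t = fracPow lamA bA r (μ t) := indicator_of_mem (hsub ht) _
    rw [Real.norm_eq_abs, abs_of_nonneg (sq_nonneg _), h1]
    exact le_add_of_nonneg_right (sq_nonneg _)
  · filter_upwards [ae_restrict_mem measurableSet_Ioi, ae_restrict_of_ae hP] with t ht hPt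
    rw [Real.norm_eq_abs, abs_of_nonneg (sq_nonneg _), hZn, indicator_of_mem (hsub ht)]
    have h1 := sq_nonneg ‖m t‖
    rcases eq_or_lt_of_le hτ.1 with h | h
    · rw [(hPt (hsub ht)).2.2.2.1 h.symm]
      simp
    · have h2 : 1 ≤ c ^ 2 := by
        rw [hc, inv_pow, Real.sq_sqrt h.le]
        exact (one_le_inv₀ h).2 hτ.2
      nlinarith [sq_nonneg ‖z t‖]

end Solution

lemma tendsto_intervalIntegral_add_one {f : ℝ → ℝ} {c : ℝ} (hf : IntegrableOn f (Ioi c))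
    {tn : ℕ → ℝ} (ht : ∀ n, c ≤ tn n) (htn : Tendsto tn atTop atTop) :
    Tendsto (fun n => ∫ t in tn n..tn n + 1, f t) atTop (𝓝 0) := by
  have h1 := intervalIntegral_tendsto_integral_Ioi c hf htn
  have h2 := intervalIntegral_tendsto_integral_Ioi c hf (tendsto_atTop_add_const_right _ (1:ℝ) htn)
  have h3 := h2.sub h1
  rw [sub_self] at h3
  refine h3.congr fun n => ?_
  have hI : ∀ s, c ≤ s → IntervalIntegrable f volume c s := fun s hs =>
    (intervalIntegrable_iff_integrableOn_Ioc_of_le hs).2 (hf.mono_set Ioc_subset_Ioi_self)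
  exact intervalIntegral.integral_interval_sub_left (hI _ (by linarith [ht n])) (hI _ (ht n))

lemma exists_seq_tendsto_zero {f : ℝ → ℝ} {c : ℝ} (hf0 : ∀ t, 0 ≤ f t)
    (hf : IntegrableOn f (Ioi c)) {P : ℝ → Prop} (hP : ∀ᵐ t ∂(volume.restrict (Ioi c)), P t)
    {tn : ℕ → ℝ} (ht : ∀ n, c ≤ tn n) (htn : Tendsto tn atTop atTop) :
    ∃ sn : ℕ → ℝ, (∀ n, tn n < sn n ∧ sn n ≤ tn n + 1) ∧ (∀ n, P (sn n)) ∧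
      Tendsto (fun n => f (sn n)) atTop (𝓝 0) := by
  have h : ∀ n, ∃ s, (tn n < s ∧ s ≤ tn n + 1) ∧ P s ∧ f s ≤ ∫ t in tn n..tn n + 1, f t := by
    intro n
    have hsub : Ioc (tn n) (tn n + 1) ⊆ Ioi c := fun s hs => lt_of_le_of_lt (ht n) hs.1
    have hN : volume {t | ¬ (c < t → P t)} = 0 :=
      ae_iff.1 ((ae_restrict_iff' measurableSet_Ioi).1 hP)
    have hvol : volume (Ioc (tn n) (tn n + 1)) = 1 := by simp
    obtain ⟨s, ⟨hs1, hle⟩, hs2⟩ := nonempty_of_measure_ne_zero (((measure_sdiff_null hN).trans_gt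
      (measure_le_setAverage_pos (μ := volume) (f := f) (s := Ioc (tn n) (tn n + 1)) (by simp)
        (by simp) (hf.mono_set hsub))).ne')
    have hPs : c < s → P s := not_not.1 hs2
    refine ⟨s, hs1, hPs (hsub hs1), hle.trans (le_of_eq ?_)⟩
    rw [setAverage_eq, intervalIntegral.integral_of_le (by linarith), measureReal_def, hvol]
    simp
  choose s hs using h
  exact ⟨s, fun n => (hs n).1, fun n => (hs n).2.1, squeeze_zero (fun n => hf0 _)
    (fun n => (hs n).2.2) (tendsto_intervalIntegral_add_one hf ht htn)⟩

section Solution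

variable {Om : Set E3} {lamA lamB : ℕ → ℝ} {bA bB : HilbertBasis ℕ ℝ (Hs Om)} {r σ τ : ℝ}
  {betah : ℝ → ℝ≥0∞} {piF : ℝ → ℝ} {u : ℝ → Hs Om} {y0 : Hs Om} {y μ : ℝ → Hs Om}
  {dy : ℝ → Hs Om →ₗ[ℝ] ℝ} {z : ℝ → Hs Om}

/-- A solution bounded in `H` for almost all times satisfies the same bound at all times, and it
belongs to `V_B^σ` at all times. -/
lemma IsSolution.inDom_and_norm_le
    (hsol : IsSolution Om lamA lamB bA bB r σ τ betah piF u y0 y μ dy z) {M : ℝ}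
    (hM : ∀ᵐ t ∂(volume.restrict (Ioi (0:ℝ))), ‖y t‖ ≤ M) {t : ℝ} (ht : 0 ≤ t) :
    inDom lamB bB σ (y t) ∧ ‖y t‖ ≤ M := by
  have hinc := fun s (hs : 0 ≤ s) v hv =>
    hsol.inner_increment_eq (s := t) (t := s) ht hs (v := v) hv
  have hm := hsol.intervalIntegrable_gradPot
  obtain ⟨-, hyd, hyC, -⟩ := hsol
  obtain ⟨C, hC⟩ := hyC (t + 1) (by linarith)
  have hae : ∀ᵐ s : ℝ, 0 < s → s ≤ t + 1 →
      inDom lamB bB σ (y s) ∧ ‖y s‖ ≤ M ∧ gnormSq lamB bB σ (y s) ≤ C := by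
    filter_upwards [(ae_restrict_iff' measurableSet_Ioi).1 hyd,
      (ae_restrict_iff' measurableSet_Ioi).1 hM, (ae_restrict_iff' measurableSet_Ioc).1 hC]
      with s h1 h2 h3 h0 h4
    exact ⟨h1 h0, h2 h0, h3 ⟨h0, h4⟩⟩
  have hex : ∀ n : ℕ, ∃ s, (t < s ∧ s < t + 1 / ((n : ℝ) + 1)) ∧
      inDom lamB bB σ (y s) ∧ ‖y s‖ ≤ M ∧ gnormSq lamB bB σ (y s) ≤ C := by
    intro n
    have hn : (0:ℝ) < 1 / ((n : ℝ) + 1) := by positivity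
    obtain ⟨s, hs, hst⟩ := (Measure.dense_of_ae hae).exists_between
      (show t < t + 1 / ((n : ℝ) + 1) by linarith)
    have hn1 : 1 / ((n : ℝ) + 1) ≤ 1 := by
      rw [div_le_one (by positivity)]
      exact le_add_of_nonneg_left n.cast_nonneg
    exact ⟨s, hst, hs (ht.trans_lt hst.1) (by linarith [hst.2])⟩
  choose s hst hs using hex
  have hslim : Tendsto s atTop (𝓝 t) := by
    refine tendsto_of_tendsto_of_tendsto_of_le_of_le tendsto_const_nhds (h := fun n : ℕ =>
      t + 1 / ((n : ℝ) + 1)) ?_ (fun n => (hst n).1.le) (fun n => (hst n).2.le)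
    simpa using tendsto_const_nhds.add (tendsto_one_div_add_atTop_nhds_zero_nat (𝕜 := ℝ))
  have hI : Tendsto (fun n => ∫ q in t..s n, gradPot lamA bA r μ q) atTop (𝓝 0) := by
    have h := ((intervalIntegral.continuous_primitive hm t).tendsto t).comp hslim
    simpa [Function.comp_def] using h
  have hlimA : ∀ φ, inDom lamA bA r φ → Tendsto (fun n => ⟪y (s n), φ⟫) atTop (𝓝 ⟪y t, φ⟫) := by
    intro φ hφ
    have h1 : Tendsto (fun n => -⟪∫ q in t..s n, gradPot lamA bA r μ q, fracPow lamA bA r φ⟫)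
        atTop (𝓝 0) := by
      simpa using (hI.inner (𝕜 := ℝ) (tendsto_const_nhds (x := fracPow lamA bA r φ))).neg
    have h2 := (tendsto_const_nhds (x := ⟪y t, φ⟫)).add h1
    rw [add_zero] at h2
    refine h2.congr fun n => ?_
    rw [← hinc (s n) (ht.trans (hst n).1.le) φ hφ, inner_sub_left]
    ring
  have hlim := tendsto_inner_of_basis (b := bA) (fun n => (hs n).2.1)
    fun j => hlimA _ (fracPow_basis j).1
  refine ⟨inDom_of_tendsto (fun n => (hs n).1) (C := C) (fun n => ?_) (fun j => hlim _), ?_⟩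
  · have h := (hs n).2.2
    rw [gnormSq] at h
    linarith [sq_nonneg ‖y (s n)‖]
  · have h1 : ‖y t‖ * ‖y t‖ ≤ M * ‖y t‖ := by
      rw [← real_inner_self_eq_norm_mul_norm]
      refine le_of_tendsto' (hlim (y t)) fun n => (real_inner_le_norm _ _).trans ?_
      exact mul_le_mul_of_nonneg_right (hs n).2.1 (norm_nonneg _)
    rcases (norm_nonneg (y t)).eq_or_lt with h | h
    · rw [← h]
      exact (norm_nonneg _).trans (hs 0).2.1
    · exact le_of_mul_le_mul_right h1 h

/-- Every element of the ω-limit set is the weak limit in `H` of the trajectory along times at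
which the solution is regular and the dissipation vanishes asymptotically. -/
lemma IsSolution.exists_good_times
    (hsol : IsSolution Om lamA lamB bA bB r σ τ betah piF u y0 y μ dy z) {M : ℝ}
    (hM : ∀ᵐ t ∂(volume.restrict (Ioi (0:ℝ))), ‖y t‖ ≤ M) {uinf : Hs Om}
    (hdis : IntegrableOn (fun t => ‖fracPow lamA bA r (μ t)‖ ^ 2) (Ioi 1))
    (hdisz : IntegrableOn (fun t => ‖z t‖ ^ 2) (Ioi 1))
    (hui : IntegrableOn (fun t => ‖u t - uinf‖ ^ 2) (Ioi (0:ℝ)))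
    {P : ℝ → Prop} (hP : ∀ᵐ t ∂(volume.restrict (Ioi (0:ℝ))), P t)
    {w : Hs Om} (hw : w ∈ omegaLimit lamB bB σ y) :
    ∃ s : ℕ → ℝ, (∀ n, P (s n)) ∧
      Tendsto (fun n => fracPow lamA bA r (μ (s n))) atTop (𝓝 0) ∧
      Tendsto (fun n => u (s n) - z (s n)) atTop (𝓝 uinf) ∧
      ∀ v : Hs Om, Tendsto (fun n => ⟪y (s n), v⟫) atTop (𝓝 ⟪w, v⟫) := by
  have hinc := fun s t (hs : 0 ≤ s) (ht : 0 ≤ t) v hv =>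
    hsol.inner_increment_eq (s := s) (t := t) hs ht (v := v) hv
  have hm := hsol.intervalIntegrable_gradPot
  have hm2 := hsol.intervalIntegrable_gradPot_sq
  have hreg := fun t (ht : 0 ≤ t) => hsol.inDom_and_norm_le hM (t := t) ht
  obtain ⟨hwd, t', -, -, ht'lim, hlim'⟩ := hw
  obtain ⟨N, hN⟩ := eventually_atTop.1 (ht'lim.eventually_ge_atTop 1)
  set t : ℕ → ℝ := fun n => t' (n + N) with ht_def
  have ht1 : ∀ n, 1 ≤ t n := fun n => hN _ (Nat.le_add_left _ _)
  have ht0 : ∀ n, 0 ≤ t n := fun n => zero_le_one.trans (ht1 n)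
  have htlim : Tendsto t atTop atTop := ht'lim.comp (tendsto_add_atTop_nat N)
  have hyt : ∀ j, Tendsto (fun n => ⟪y (t n), bB j⟫) atTop (𝓝 ⟪w, bB j⟫) := by
    intro j
    have hpos : (0:ℝ) < 1 + (lamB j ^ σ) ^ 2 := by positivity
    have h1 := ((hlim' (bB j) (fracPow_basis j).1).comp (tendsto_add_atTop_nat N)).const_mul
      (1 + (lamB j ^ σ) ^ 2)⁻¹
    have h2 : ∀ v : Hs Om, inDom lamB bB σ v →
        (1 + (lamB j ^ σ) ^ 2)⁻¹ * innerFrac lamB bB σ v (bB j) = ⟪v, bB j⟫ := fun v hv => by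
      rw [innerFrac, inner_fracPow_basis hv]
      field_simp
    rw [h2 w hwd] at h1
    exact h1.congr fun n => h2 _ (hreg _ (ht0 n)).1
  have hyt' := tendsto_inner_of_basis (fun n => (hreg _ (ht0 n)).2) hyt
  set f : ℝ → ℝ := fun t => ‖fracPow lamA bA r (μ t)‖ ^ 2 + ‖z t‖ ^ 2 + ‖u t - uinf‖ ^ 2 with hf
  have hsub : Ioi (1:ℝ) ⊆ Ioi 0 := Ioi_subset_Ioi zero_le_one
  have hfi : IntegrableOn f (Ioi 1) := (hdis.add hdisz).add (hui.mono_set hsub)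
  obtain ⟨s, hs, hPs, hflim⟩ := exists_seq_tendsto_zero (fun t => by positivity) hfi
    (P := fun t => P t ∧ ‖y t‖ ≤ M) (ae_restrict_of_ae_restrict_of_subset hsub (hP.and hM))
    ht1 htlim
  have hsqrt : ∀ {g : ℝ → Hs Om}, (∀ t, ‖g t‖ ^ 2 ≤ f t) →
      Tendsto (fun n => g (s n)) atTop (𝓝 0) := by
    intro g hg
    refine tendsto_zero_iff_norm_tendsto_zero.2 ?_
    have h1 : Tendsto (fun n => √(f (s n))) atTop (𝓝 0) := by
      simpa [Function.comp_def] using (Real.continuous_sqrt.tendsto 0).comp hflim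
    exact squeeze_zero (fun n => norm_nonneg _) (fun n => Real.le_sqrt_of_sq_le (hg _)) h1
  have hm0 := hsqrt (g := fun t => fracPow lamA bA r (μ t)) fun t => by
    simp only [hf]; linarith [sq_nonneg ‖z t‖, sq_nonneg ‖u t - uinf‖]
  have hz0 := hsqrt (g := z) fun t => by
    simp only [hf]
    linarith [sq_nonneg ‖fracPow lamA bA r (μ t)‖, sq_nonneg ‖u t - uinf‖]
  have hu0 := hsqrt (g := fun t => u t - uinf) fun t => by
    simp only [hf]
    linarith [sq_nonneg ‖fracPow lamA bA r (μ t)‖, sq_nonneg ‖z t‖]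
  have hI : Tendsto (fun n => ∫ q in t n..s n, gradPot lamA bA r μ q) atTop (𝓝 0) := by
    have hmi : IntegrableOn (fun t => ‖gradPot lamA bA r μ t‖ ^ 2) (Ioi 1) := by
      refine hdis.congr_fun (fun t ht => ?_) measurableSet_Ioi
      simp only [gradPot]
      rw [indicator_of_mem (hsub ht)]
    have h1 := tendsto_intervalIntegral_add_one hmi ht1 htlim
    refine tendsto_zero_iff_norm_tendsto_zero.2 ?_
    have h2 := (Real.continuous_sqrt.tendsto 0).comp h1
    rw [Real.sqrt_zero] at h2
    refine squeeze_zero (fun n => norm_nonneg _) (fun n => Real.le_sqrt_of_sq_le ?_) h2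
    have h3 := norm_integral_sq_le (hs n).1.le (hm (t n) (s n)) (hm2 (t n) (s n))
    have h4 : ∫ q in t n..s n, ‖gradPot lamA bA r μ q‖ ^ 2
        ≤ ∫ q in t n..t n + 1, ‖gradPot lamA bA r μ q‖ ^ 2 :=
      intervalIntegral.integral_mono_interval le_rfl (hs n).1.le (hs n).2
        (Eventually.of_forall fun q => sq_nonneg _) (hm2 _ _)
    have h5 : 0 ≤ ∫ q in t n..s n, ‖gradPot lamA bA r μ q‖ ^ 2 :=
      intervalIntegral.integral_nonneg (hs n).1.le fun q _ => sq_nonneg _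
    nlinarith [(hs n).1, (hs n).2]
  refine ⟨s, fun n => (hPs n).1, hm0, ?_, ?_⟩
  · have h := (hu0.sub hz0).add (tendsto_const_nhds (x := uinf))
    rw [sub_zero, zero_add] at h
    exact h.congr fun n => by abel
  · refine tendsto_inner_of_basis (b := bA) (fun n => (hPs n).2) fun j => ?_
    have hφ := (fracPow_basis (b := bA) (lam := lamA) (ρ := r) j).1
    generalize bA j = φ at hφ ⊢
    have h1 : Tendsto (fun n => -⟪∫ q in t n..s n, gradPot lamA bA r μ q, fracPow lamA bA r φ⟫)
        atTop (𝓝 0) := by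
      simpa using (hI.inner (𝕜 := ℝ) (tendsto_const_nhds (x := fracPow lamA bA r φ))).neg
    have h2 := (hyt' φ).add h1
    rw [add_zero] at h2
    refine h2.congr fun n => ?_
    rw [← hinc (t n) (s n) (ht0 n) ((ht0 n).trans (hs n).1.le) φ hφ, inner_sub_left]
    ring

end Solution

/-- Existence, for an element of the ω-limit set, of the stationary equation tested with the
eigenvectors of `B`. -/
lemma IsSolution.exists_stationary {Om : Set E3} [IsFiniteMeasure (mOm Om)] {lamA lamB : ℕ → ℝ}
    {bA bB : HilbertBasis ℕ ℝ (Hs Om)} {r σ τ : ℝ}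
    {betah : ℝ → ℝ≥0∞} {pih piF : ℝ → ℝ} {Lpi : ℝ≥0} {u u' : ℝ → Hs Om} {y0 uinf : Hs Om}
    {y μ : ℝ → Hs Om} {dy : ℝ → Hs Om →ₗ[ℝ] ℝ} {z : ℝ → Hs Om}
    (hsol : IsSolution Om lamA lamB bA bB r σ τ betah piF u y0 y μ dy z)
    (hlamB : Tendsto lamB atTop atTop) (hr : 0 < r) (hσ : 0 < σ) (hτ : τ ∈ Icc (0:ℝ) 1)
    (hmonoA : Monotone lamA) (h1 : 0 < lamA 1)
    (he : inDom lamB bB σ (bA 0)) (hebd : ∃ C : ℝ, ∀ᵐ x ∂(mOm Om), |bA 0 x| ≤ C)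
    (hlsc : LowerSemicontinuous betah)
    (hd : ∀ s, HasDerivAt pih (piF s) s) (hL : LipschitzWith Lpi piF)
    (hu' : IntegrableOn u' (Ioi (0:ℝ)))
    (hu : ∀ t : ℝ, 0 ≤ t → u t = u 0 + ∫ s in (0:ℝ)..t, u' s)
    (hui : IntegrableOn (fun t => ‖u t - uinf‖ ^ 2) (Ioi (0:ℝ)))
    {a b δ Bd : ℝ} {g : ℝ → ℝ} {L : ℝ≥0} (hab : a ≤ b) (hδ : 0 < δ) (hg : LipschitzWith L g)
    (hbd : ∀ s ∈ Icc (a - δ) (b + δ), betah s ≤ ENNReal.ofReal Bd)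
    (hsub : ∀ s ∈ Icc (a - δ) (b + δ), ∀ t ∈ Icc (a - δ) (b + δ),
      (betah s).toReal + g s * (t - s) ≤ (betah t).toReal)
    (hyab : ∀ᵐ t ∂(volume.restrict (Ioi (0:ℝ))), ∀ᵐ x ∂(mOm Om), y t x ∈ Icc a b)
    (hdense : ∀ v : Hs Om, inDom lamB bB σ v → ∀ ε : ℝ, 0 < ε →
      ∃ w : Hs Om, inDom lamB bB σ w ∧ (∃ C : ℝ, ∀ᵐ x ∂(mOm Om), |w x| ≤ C) ∧
        gnormSq lamB bB σ (v - w) < ε)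
    {w : Hs Om} (hw : w ∈ omegaLimit lamB bB σ y) :
    (∀ᵐ x ∂(mOm Om), w x ∈ Icc a b) ∧ ∃ κ : ℝ, ∀ j, (lamB j ^ σ) ^ 2 * ⟪w, bB j⟫
      + ⟪superpos g hg w + superpos piF hL w - uinf - κ • bA 0, bB j⟫ = 0 := by
  have hIcc : Icc a b ⊆ Icc (a - δ) (b + δ) := Icc_subset_Icc (by linarith) (by linarith)
  obtain ⟨K, k, hk, hbk⟩ := exists_lipschitz_potential hg hd hL
    (fun s hs t ht => hsub s (hIcc hs) t (hIcc ht))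
  obtain ⟨hdis, hdisz⟩ := hsol.integrableOn_dissipation hlamB hσ hτ hlsc
    (fun s hs => hbd s (hIcc hs)) hd hL hk hbk hu' hu hyab
  obtain ⟨M, -, hM⟩ := exists_norm_le_of_ae_mem_Icc Om a b
  have htimes := fun P hP => hsol.exists_good_times (hyab.mono fun t ht => hM _ ht) hdis hdisz hui
    (P := P) hP hw
  obtain ⟨-, hyd, -, -, -, -, -, -, -, -, hμd, -, -, -, hineq, -⟩ := hsol
  obtain ⟨s, hP, hm, hR, hlim⟩ := htimes _ ((hyd.and hyab).and (hμd.and hineq))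
  have hbound : ∀ v : Hs Om, (∀ᵐ x ∂(mOm Om), v x ∈ Icc a b) →
      ∃ C : ℝ, ∀ᵐ x ∂(mOm Om), |v x| ≤ C := fun v hv =>
    ⟨max |a| |b|, hv.mono fun x hx => abs_le_max_abs_abs hx.1 hx.2⟩
  set G : Hs Om → Hs Om := fun v => superpos g hg v + superpos piF hL v with hG
  have hGM : ∀ n, ‖G (y (s n))‖ ≤ (‖superpos g hg (0 : Hs Om)‖ + L * M)
      + (‖superpos piF hL (0 : Hs Om)‖ + Lpi * M) := by
    intro n
    have h := hM _ (hP n).1.2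
    refine (norm_add_le _ _).trans (add_le_add ?_ ?_)
    · exact (norm_superpos_le hg _).trans (by gcongr)
    · exact (norm_superpos_le hL _).trans (by gcongr)
  obtain ⟨hstrong, hκ⟩ := exists_stationary_limit hlamB hσ hmonoA h1 hr hdense he hebd
    (G := G) (v := fun n => y (s n)) (μ := fun n => μ (s n)) (R := fun n => u (s n) - z (s n))
    (w := w) ((lipschitzWith_superpos hg).continuous.add (lipschitzWith_superpos hL).continuous)
    (fun n => hM _ (hP n).1.2) hGM (fun n => (hP n).1.1) (fun n => hbound _ (hP n).1.2)
    (fun n => (hP n).2.1) hm hR (fun n φ hφ ⟨C, hC⟩ => by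
      have h := weak_eq_of_bounded (p := superpos piF hL (y (s n)) - u (s n))
        (M := μ (s n) - z (s n)) hg hlsc hδ hbd hsub (hP n).1.1 (hP n).1.2 (fun v hv hv' => by
          have h := (hP n).2.2 v hv hv'
          rw [integral_sub_mul_sub hL] at h
          rw [inner_sub_left (μ (s n))]
          linarith) hφ hC
      rw [← h]
      congr 2
      simp only [hG]
      abel) hw.1 (fun j => hlim _)
  exact ⟨ae_mem_Icc_of_tendsto hab (fun n => (hP n).1.2) hstrong, hκ⟩

/-- The multiplier in the stationary variational inequality is determined by the stationary
equation. -/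
lemma smul_one_eq_of_ineq {Om : Set E3} [IsFiniteMeasure (mOm Om)] {lam : ℕ → ℝ} {σ : ℝ}
    {e : HilbertBasis ℕ ℝ (Hs Om)} {betah : ℝ → ℝ≥0∞} {piF : ℝ → ℝ} {Lpi : ℝ≥0}
    (hlsc : LowerSemicontinuous betah) (hL : LipschitzWith Lpi piF)
    {a b δ Bd : ℝ} {g : ℝ → ℝ} {L : ℝ≥0} (hδ : 0 < δ) (hg : LipschitzWith L g)
    (hbd : ∀ s ∈ Icc (a - δ) (b + δ), betah s ≤ ENNReal.ofReal Bd)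
    (hsub : ∀ s ∈ Icc (a - δ) (b + δ), ∀ t ∈ Icc (a - δ) (b + δ),
      (betah s).toReal + g s * (t - s) ≤ (betah t).toReal)
    (hdense : ∀ v : Hs Om, inDom lam e σ v → ∀ ε : ℝ, 0 < ε →
      ∃ w : Hs Om, inDom lam e σ w ∧ (∃ C : ℝ, ∀ᵐ x ∂(mOm Om), |w x| ≤ C) ∧
        gnormSq lam e σ (v - w) < ε)
    {w uinf q : Hs Om} (hw : inDom lam e σ w) (hwab : ∀ᵐ x ∂(mOm Om), w x ∈ Icc a b)
    (hq : ∀ j, (lam j ^ σ) ^ 2 * ⟪w, e j⟫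
      + ⟪superpos g hg w + superpos piF hL w - uinf - q, e j⟫ = 0)
    {m : ℝ} (hineq : ∀ v : Hs Om, inDom lam e σ v → (∫⁻ x, betah (v x) ∂(mOm Om)) < ⊤ →
      ⟪fracPow lam e σ w, fracPow lam e σ w - fracPow lam e σ v⟫
        + (∫⁻ x, betah (w x) ∂(mOm Om)).toReal
        + ∫ x, (piF (w x) - uinf x) * (w x - v x) ∂(mOm Om)
        ≤ m * ∫ x, (w x - v x) ∂(mOm Om) + (∫⁻ x, betah (v x) ∂(mOm Om)).toReal) :
    m • (Lp.const 2 (mOm Om) (1 : ℝ) : Hs Om) = q := by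
  refine ext_inner_basis e fun j => ?_
  have h1 := weak_eq_of_dense hdense
    (R := superpos g hg w + (superpos piF hL w - uinf) - m • Lp.const 2 (mOm Om) (1 : ℝ))
    (fun φ hφ ⟨C, hC⟩ => weak_eq_of_bounded hg hlsc hδ hbd hsub hw hwab (fun v hv hv' => by
      have h := hineq v hv hv'
      rw [integral_sub_mul_sub hL] at h
      have h2 : ∫ x, (w x - v x) ∂(mOm Om) = ∫ x, (w - v) x ∂(mOm Om) :=
        integral_congr_ae ((Lp.coeFn_sub w v).mono fun x hx => hx.symm)
      rw [h2, integral_eq_inner_one, real_inner_comm (Lp.const 2 (mOm Om) (1 : ℝ))] at h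
      rwa [real_inner_smul_left]) hφ hC)
    (fracPow_basis j).1
  have h2 := hq j
  rw [inner_fracPow_basis hw] at h1
  simp only [inner_sub_left, inner_add_left] at h1 h2
  linarith

/-- **Proposition 2.4.** Under the assumptions of the longtime-behaviour theorem with
`λ₁ = 0`, assume in addition that `D(β)` is an open interval on which `β` is a
single-valued `C¹` function `bfun`, that the solution satisfies `y(x,t) ∈ [a,b]` for a
compact interval `[a,b] ⊂ D(β)`, and that `V_B^σ ∩ L^∞(Om)` is dense in `V_B^σ`.
Then, for every element `y_ω` of the ω-limit set, `y_ω ∈ V_B^{2σ}` and there is a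
(unique) constant `c` such that the strong stationary equation
`B^{2σ} y_ω + β(y_ω) + π(y_ω) = c + u_∞` holds a.e. in `Om`; moreover every function
`μ_∞ ∈ L^∞_loc([0,+∞))` appearing in the characterization of `y_ω` coincides a.e. with
this constant `c`. -/
theorem strong_stationary_characterization
    (Om : Set E3) (lamA lamB : ℕ → ℝ) (eA eB : ℕ → Hs Om) (r σ τ : ℝ)
    (betah : ℝ → ℝ≥0∞) (pih piF : ℝ → ℝ) (Lpi : ℝ≥0)
    (u u' : ℝ → Hs Om) (y0 : Hs Om)
    (hset : SettingHyps Om lamA lamB eA eB r σ τ)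
    (hdata : DataHyps Om lamA lamB eB σ betah pih piF Lpi u u' y0)
    (hlam : lamA 0 = 0)
    (uinf : Hs Om) (hui : IntegrableOn (fun t => ‖u t - uinf‖ ^ 2) (Set.Ioi (0:ℝ)))
    (y μ : ℝ → Hs Om) (dy : ℝ → Hs Om →ₗ[ℝ] ℝ) (z : ℝ → Hs Om)
    (hsol : IsSolution Om lamA lamB eA eB r σ τ betah piF u y0 y μ dy z)
    (hDopen : IsOpen {s : ℝ | (subdiff betah s).Nonempty})
    (hDconn : Set.OrdConnected {s : ℝ | (subdiff betah s).Nonempty})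
    (bfun : ℝ → ℝ)
    (hbC1 : ContDiffOn ℝ 1 bfun {s : ℝ | (subdiff betah s).Nonempty})
    (hbsingle : ∀ s ∈ {s : ℝ | (subdiff betah s).Nonempty}, subdiff betah s = {bfun s})
    (a b : ℝ) (hab : a ≤ b)
    (habD : Set.Icc a b ⊆ {s : ℝ | (subdiff betah s).Nonempty})
    (hyab : ∀ᵐ t ∂(volume.restrict (Set.Ioi (0:ℝ))),
      ∀ᵐ x ∂(mOm Om), y t x ∈ Set.Icc a b)
    (hdense : ∀ v : Hs Om, inDom lamB eB σ v → ∀ ε : ℝ, 0 < ε →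
      ∃ w : Hs Om, inDom lamB eB σ w ∧ (∃ C : ℝ, ∀ᵐ x ∂(mOm Om), |w x| ≤ C) ∧
        gnormSq lamB eB σ (v - w) < ε) :
    ∀ w ∈ omegaLimit lamB eB σ y,
      inDom lamB eB (2 * σ) w ∧
      ∃ c : ℝ,
        (∀ᵐ x ∂(mOm Om),
          fracPow lamB eB (2 * σ) w x + bfun (w x) + piF (w x) = c + uinf x) ∧
        (∀ μinf : ℝ → ℝ,
          (∀ T : ℝ, 0 < T → ∃ C : ℝ,
            ∀ᵐ t ∂(volume.restrict (Set.Ioc (0:ℝ) T)), |μinf t| ≤ C) →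
          (∀ᵐ t ∂(volume.restrict (Set.Ioi (0:ℝ))),
            ∀ v : Hs Om, inDom lamB eB σ v → (∫⁻ x, betah (v x) ∂(mOm Om)) < ⊤ →
              ⟪fracPow lamB eB σ w, fracPow lamB eB σ w - fracPow lamB eB σ v⟫
                + (∫⁻ x, betah (w x) ∂(mOm Om)).toReal
                + ∫ x, (piF (w x) - uinf x) * (w x - v x) ∂(mOm Om)
                ≤ μinf t * ∫ x, (w x - v x) ∂(mOm Om)
                  + (∫⁻ x, betah (v x) ∂(mOm Om)).toReal) →
          ∀ᵐ t ∂(volume.restrict (Set.Ioi (0:ℝ))), μinf t = c) := by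
  obtain ⟨hOpen, -, hOmb, -, hlamB0, hmonoA, -, -, hlamB, hoA, hoB, hcA, hcB, hr, hσ, hτ, hcase,
    hconst⟩ := hset
  obtain ⟨-, hlsc, -, hd, hL, -, hu', hu, -, -, -⟩ := hdata
  obtain ⟨h1, c0, hc0⟩ : 0 < lamA 1 ∧ ∃ c : ℝ, ∀ᵐ x ∂(mOm Om), eA 0 x = c := by
    rcases hcase with h | h
    · exact absurd hlam h.ne'
    · exact h.2
  have : IsFiniteMeasure (mOm Om) := isFiniteMeasure_restrict.2 hOmb.measure_lt_top.ne
  obtain ⟨bA, rfl⟩ : ∃ bA : HilbertBasis ℕ ℝ (Hs Om), eA = bA :=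
    ⟨HilbertBasis.mk hoA hcA.ge, (HilbertBasis.coe_mk hoA hcA.ge).symm⟩
  obtain ⟨bB, rfl⟩ : ∃ bB : HilbertBasis ℕ ℝ (Hs Om), eB = bB :=
    ⟨HilbertBasis.mk hoB hcB.ge, (HilbertBasis.coe_mk hoB hcB.ge).symm⟩
  have he : inDom lamB bB σ (bA 0) := by
    obtain ⟨e, he, hec⟩ := hconst hlam c0
    have : e = bA 0 := by
      ext1
      filter_upwards [hec, hc0] with x h1 h2
      rw [h1, h2]
    rwa [← this]
  have hebd : ∃ C : ℝ, ∀ᵐ x ∂(mOm Om), |bA 0 x| ≤ C := ⟨|c0|, hc0.mono fun x hx => by rw [hx]⟩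
  have hOm0 : NeBot (ae (mOm Om)) := by
    by_contra h
    rw [not_neBot] at h
    have h2 : bA 0 = 0 := by
      ext1
      rw [EventuallyEq, h]
      exact eventually_bot
    have h3 := hoA.1 0
    rw [h2] at h3
    simp at h3
  obtain ⟨δ, Bd, L, g, hδ, hg, hbg, hbd, hsub⟩ :=
    exists_regular_extension hDopen hDconn hbC1 hbsingle hab habD
  intro w hw
  obtain ⟨hwab, κ, hκ⟩ := hsol.exists_stationary hlamB hr hσ hτ hmonoA h1 he hebd hlsc hd hL
    hu' hu hui hab hδ hg hbd hsub hyab hdense hw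
  obtain ⟨hdom, hpow⟩ := fracPow_eq (lam := lamB) (b := bB) (ρ := 2 * σ) (v := w)
    (x := -(superpos g hg w + superpos piF hL w - uinf - κ • bA 0)) (fun j => by
      rw [mul_comm 2 σ, Real.rpow_mul (hlamB0 j), Real.rpow_two, inner_neg_left]
      linarith [hκ j])
  refine ⟨hdom, κ * c0, ?_, fun μinf _ hμinf => ?_⟩
  · rw [hpow]
    filter_upwards [Lp.coeFn_neg (superpos g hg w + superpos piF hL w - uinf - κ • bA 0),
      Lp.coeFn_sub (superpos g hg w + superpos piF hL w - uinf) (κ • bA 0),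
      Lp.coeFn_sub (superpos g hg w + superpos piF hL w) uinf,
      Lp.coeFn_add (superpos g hg w) (superpos piF hL w), Lp.coeFn_smul κ (bA 0),
      coeFn_superpos hg w, coeFn_superpos hL w, hwab, hc0] with x h1 h2 h3 h4 h5 h6 h7 h8 h9
    rw [h1, Pi.neg_apply, h2, Pi.sub_apply, h3, Pi.sub_apply, h4, Pi.add_apply, h5, Pi.smul_apply,
      h6, h7, h9, hbg ⟨by linarith [h8.1], by linarith [h8.2]⟩, smul_eq_mul]
    ring
  · filter_upwards [hμinf] with t ht
    have h2 := smul_one_eq_of_ineq hlsc hL hδ hg hbd hsub hdense hw.1 hwab hκ ht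
    have h3 : ∀ᵐ x ∂(mOm Om), μinf t = κ * c0 := by
      filter_upwards [Lp.coeFn_smul (μinf t) (Lp.const 2 (mOm Om) (1 : ℝ) : Hs Om),
        Lp.coeFn_smul κ (bA 0), coeFn_const_one (Om := Om), hc0] with x h4 h5 h6 h7
      rw [← h2, h4, Pi.smul_apply, Pi.smul_apply, h6, h7] at h5
      simpa using h5
    exact h3.exists.choose_spec

end FracCH
end
end

section
/- Assume λ₁ = 0 (so 0 = λ₁ < λ₂, e₁ is constant, and constants belong to V_B^σ). Take β̂(s) := s² + |s| for s ∈ ℝ, π̂ = 0, y₀ = 0, and u = 0. Then for every function μ̄ ∈ L∞(0,+∞) with |μ̄(t)| ≤ 1 for a.a. t, the pair (y,μ) defined by y(x,t) = 0 and μ(x,t) = μ̄(t) is a solution of the fractional Cahn–Hilliard system; it even satisfies the strong form τ∂_t y + B^{2σ}y + ξ + π(y) = μ + u with ξ = μ ∈ β(y) = β(0) = [−1,1]. Consequently, the only element of the ω-limit set is y_ω = 0, while every such μ̄ is an admissible function μ_∞ in the characterization of y_ω; in particular, μ_∞ is neither unique nor constant in general. -/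
noncomputable section

open MeasureTheory Filter Topology RealInnerProductSpace Set ENNReal NNReal

namespace FracCH

theorem inDom_of_orthogonal {Om : Set E3} {lam : ℕ → ℝ} {e : ℕ → Hs Om} {ρ : ℝ} {v : Hs Om}
    (h : ∀ j, (lam j) ^ ρ * ⟪v, e j⟫ = 0) : inDom lam e ρ v := by
  simp [inDom, h, summable_zero]

theorem fracPow_of_orthogonal {Om : Set E3} {lam : ℕ → ℝ} {e : ℕ → Hs Om} {ρ : ℝ} {v : Hs Om}
    (h : ∀ j, (lam j) ^ ρ * ⟪v, e j⟫ = 0) : fracPow lam e ρ v = 0 := by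
  simp [fracPow, h]

theorem inDom_zero {Om : Set E3} (lam : ℕ → ℝ) (e : ℕ → Hs Om) (ρ : ℝ) :
    inDom lam e ρ 0 :=
  inDom_of_orthogonal fun j => by simp

theorem fracPow_zero {Om : Set E3} (lam : ℕ → ℝ) (e : ℕ → Hs Om) (ρ : ℝ) :
    fracPow lam e ρ 0 = 0 :=
  fracPow_of_orthogonal fun j => by simp

/-- The only weak limit of the zero trajectory is zero. -/
theorem omegaLimit_zero {Om : Set E3} (lamB : ℕ → ℝ) (eB : ℕ → Hs Om) (σ : ℝ) :
    omegaLimit lamB eB σ (fun _ => (0 : Hs Om)) = {(0 : Hs Om)} := by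
  ext w
  simp only [omegaLimit, mem_ofPred_eq, mem_singleton_iff]
  constructor
  · rintro ⟨hw, tn, -, -, -, hlim⟩
    have h := tendsto_nhds_unique (hlim w hw) tendsto_const_nhds
    simp only [innerFrac, fracPow_zero, inner_zero_left, real_inner_self_eq_norm_sq] at h
    have h' : ‖w‖ ^ 2 = 0 := by nlinarith [sq_nonneg ‖w‖, sq_nonneg ‖fracPow lamB eB σ w‖]
    simpa using h'
  · rintro rfl
    exact ⟨inDom_zero _ _ _, fun n => (n : ℝ), Nat.strictMono_cast, fun n => n.cast_nonneg,
      tendsto_natCast_atTop_atTop, fun φ _ => tendsto_const_nhds⟩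

theorem subdiff_sq_add_abs_zero :
    subdiff (fun s => ENNReal.ofReal (s ^ 2 + |s|)) 0 = Set.Icc (-1 : ℝ) 1 := by
  ext ξ
  have hiff : ∀ t : ℝ, ENNReal.ofReal (ξ * t) ≤ ENNReal.ofReal (t ^ 2 + |t|) ↔
      ξ * t ≤ t ^ 2 + |t| := fun t => ENNReal.ofReal_le_ofReal_iff (by positivity)
  simp only [subdiff, mem_ofPred_eq, mem_Icc, ne_eq,
    OfNat.ofNat_ne_zero, not_false_eq_true, zero_pow, abs_zero, add_zero, ENNReal.ofReal_zero,
    ENNReal.toReal_zero, zero_add, sub_zero, ENNReal.zero_lt_top, true_and,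
    hiff]
  constructor
  · intro h
    constructor
    · refine neg_le.mp (le_of_forall_pos_le_add fun ε hε => ?_)
      have := h (-ε)
      rw [abs_neg, abs_of_pos hε] at this
      nlinarith
    · refine le_of_forall_pos_le_add fun ε hε => ?_
      have := h ε
      rw [abs_of_pos hε] at this
      nlinarith
  · intro h t
    have h1 : |ξ| ≤ 1 := abs_le.mpr h
    calc ξ * t ≤ |ξ| * |t| := by rw [← abs_mul]; exact le_abs_self _
      _ ≤ 1 * |t| := by gcongr
      _ ≤ t ^ 2 + |t| := by nlinarith [sq_nonneg t]

theorem eq_smul_of_ae_const {Om : Set E3} {one v : Hs Om} {c : ℝ}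
    (hone : ∀ᵐ x ∂(mOm Om), one x = 1) (hv : ∀ᵐ x ∂(mOm Om), v x = c) : v = c • one := by
  refine Lp.ext ?_
  filter_upwards [hone, hv, Lp.coeFn_smul c one] with x h1 h2 h3
  simp [h1, h2, h3]

/-- The function `1` lies in the kernel of a fractional power with positive exponent when the
first eigenvalue vanishes and the first eigenvector is constant. -/
theorem rpow_mul_inner_one_eq_zero {Om : Set E3} {lam : ℕ → ℝ} {e : ℕ → Hs Om} {ρ : ℝ}
    {one : Hs Om} {c : ℝ} (hρ : 0 < ρ) (he : Orthonormal ℝ e) (hlam : lam 0 = 0)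
    (hone : ∀ᵐ x ∂(mOm Om), one x = 1) (hc : ∀ᵐ x ∂(mOm Om), e 0 x = c) (j : ℕ) :
    (lam j) ^ ρ * ⟪one, e j⟫ = 0 := by
  rcases eq_or_ne j 0 with rfl | hj
  · simp [hlam, Real.zero_rpow hρ.ne']
  · have h0 := eq_smul_of_ae_const hone hc
    have hc0 : c ≠ 0 := by
      rintro rfl
      exact he.ne_zero 0 (by simpa using h0)
    have h : ⟪e 0, e j⟫ = 0 := he.2 hj.symm
    rw [h0, real_inner_smul_left] at h
    simp [(mul_eq_zero.mp h).resolve_left hc0]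

theorem mul_inner_one_le {Om : Set E3} [IsFiniteMeasure (mOm Om)] {one : Hs Om}
    (hone : ∀ᵐ x ∂(mOm Om), one x = 1) {m : ℝ} (hm : |m| ≤ 1) (v : Hs Om) :
    m * ⟪one, v⟫ ≤ (∫⁻ x, ENNReal.ofReal ((v x) ^ 2 + |v x|) ∂(mOm Om)).toReal := by
  have hv : MemLp v 2 (mOm Om) := Lp.memLp v
  have hi : Integrable v (mOm Om) := hv.integrable (by norm_num)
  have hinner : ⟪one, v⟫ = ∫ x, v x ∂(mOm Om) := by
    rw [L2.inner_def]
    refine integral_congr_ae ?_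
    filter_upwards [hone] with x hx
    simp [hx]
  have hsum : Integrable (fun x => (v x) ^ 2 + |v x|) (mOm Om) := hv.integrable_sq.add hi.abs
  rw [hinner, ← integral_const_mul, ← integral_eq_lintegral_of_nonneg_ae
    (Eventually.of_forall fun x => by positivity) hsum.1]
  refine integral_mono (hi.const_mul m) hsum fun x => ?_
  calc m * v x ≤ |m| * |v x| := by rw [← abs_mul]; exact le_abs_self _
    _ ≤ 1 * |v x| := by gcongr
    _ ≤ (v x) ^ 2 + |v x| := by nlinarith [sq_nonneg (v x)]

/-- **Example 2.3.** Assume `λ₁ = 0`.  Take `β̂(s) = s² + |s|`, `π̂ = 0` (so `π = 0`),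
`y₀ = 0` and `u = 0`.  Then for every `μ̄ ∈ L^∞(0,+∞)` with `|μ̄(t)| ≤ 1` for a.a. `t`,
the pair `(y, μ)` given by `y = 0` and `μ(t) = μ̄(t) · 1` is a solution of the fractional
Cahn--Hilliard system; the only element of the ω-limit set is `y_ω = 0`; and since
`β(0) = [-1,1]`, the function `μ̄` takes values in `β(0)` a.e. (so the strong form holds
with `ξ = μ`), i.e. every such `μ̄` is an admissible `μ_∞`: `μ_∞` is neither unique nor
constant in general. -/
theorem example_nonuniqueness_of_muinfty
    (Om : Set E3) (lamA lamB : ℕ → ℝ) (eA eB : ℕ → Hs Om) (r σ τ : ℝ)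
    (hset : SettingHyps Om lamA lamB eA eB r σ τ)
    (hlam : lamA 0 = 0)
    (betah : ℝ → ℝ≥0∞) (hbetah : betah = fun s => ENNReal.ofReal (s ^ 2 + |s|))
    (piF : ℝ → ℝ) (hpiF : ∀ s, piF s = 0)
    (u : ℝ → Hs Om) (hu : ∀ t, u t = 0)
    (one : Hs Om) (hone : ∀ᵐ x ∂(mOm Om), one x = 1)
    (mubar : ℝ → ℝ) (hmeas : Measurable mubar)
    (hbound : ∀ᵐ t ∂(volume.restrict (Set.Ioi (0:ℝ))), |mubar t| ≤ 1) :
    IsSolution Om lamA lamB eA eB r σ τ betah piF u (0 : Hs Om)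
      (fun _ => (0 : Hs Om)) (fun t => mubar t • one)
      (fun _ => (0 : Hs Om →ₗ[ℝ] ℝ)) (fun _ => (0 : Hs Om)) ∧
    omegaLimit lamB eB σ (fun _ => (0 : Hs Om)) = {(0 : Hs Om)} ∧
    subdiff betah 0 = Set.Icc (-1 : ℝ) 1 ∧
    (∀ᵐ t ∂(volume.restrict (Set.Ioi (0:ℝ))), mubar t ∈ subdiff betah 0) := by
  obtain ⟨-, -, hbdd, -, -, -, -, -, -, heA, -, -, -, hr, -, -, hA, -⟩ := hset
  obtain ⟨-, -, c, hc⟩ := hA.resolve_left (by simp [hlam])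
  have : IsFiniteMeasure (mOm Om) := ⟨by simpa using hbdd.measure_lt_top⟩
  subst hbetah
  have hker : ∀ (m : ℝ) (j : ℕ), (lamA j) ^ r * ⟪m • one, eA j⟫ = 0 := fun m j => by
    rw [real_inner_smul_left, mul_left_comm, rpow_mul_inner_one_eq_zero hr heA hlam hone hc,
      mul_zero]
  have hzero : ∀ᵐ x ∂(mOm Om), (0 : Hs Om) x = 0 := Lp.coeFn_zero ℝ 2 _
  have hbeta0 : ∫⁻ x, ENNReal.ofReal (((0 : Hs Om) x) ^ 2 + |(0 : Hs Om) x|) ∂(mOm Om) = 0 := by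
    rw [← lintegral_zero (μ := mOm Om)]
    refine lintegral_congr_ae ?_
    filter_upwards [hzero] with x hx
    rw [hx]
    simp
  have hg : ∀ t, gnormSq lamA eA r (mubar t • one) = mubar t ^ 2 * ‖one‖ ^ 2 := fun t => by
    simp [gnormSq, fracPow_of_orthogonal (hker (mubar t)), norm_smul, mul_pow]
  refine ⟨⟨aestronglyMeasurable_const, .of_forall fun _ => inDom_zero _ _ _,
    fun T _ => ⟨_, .of_forall fun _ => le_rfl⟩, fun v _ T _ => by simp, fun v _ t _ => by simp,
    fun T _ => integrableOn_const (by simp), aestronglyMeasurable_const,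
    .of_forall fun t v _ => by simp, fun T _ => by simp,
    hmeas.aestronglyMeasurable.smul_const one,
    .of_forall fun t => inDom_of_orthogonal (hker _), fun T _ => ?_, fun T _ => ?_,
    .of_forall fun t v _ => ?_, ?_, rfl⟩, omegaLimit_zero _ _ _, subdiff_sq_add_abs_zero, ?_⟩
  · simp only [hg]
    refine Integrable.mul_const ?_ _
    refine Integrable.of_bound (hmeas.pow_const 2).aestronglyMeasurable 1 ?_
    filter_upwards [ae_restrict_of_ae_restrict_of_subset Ioc_subset_Ioi_self hbound] with t ht
    rw [norm_pow, Real.norm_eq_abs]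
    exact pow_le_one₀ (abs_nonneg _) ht
  · simp only [hbeta0, lintegral_zero, ENNReal.zero_lt_top]
  · simp [fracPow_of_orthogonal (hker _)]
  · filter_upwards [hbound] with t ht v _ _
    have hint : ∫ x, (piF ((0 : Hs Om) x) - u t x) * ((0 : Hs Om) x - v x) ∂(mOm Om) = 0 := by
      refine integral_eq_zero_of_ae ?_
      filter_upwards [hzero] with x hx
      rw [hu, hpiF, hx]
      simp
    have hle := mul_inner_one_le hone ht v
    simp only [hint, hbeta0, fracPow_zero, inner_zero_left, ENNReal.toReal_zero, add_zero,
      zero_sub, inner_neg_right, real_inner_smul_left]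
    linarith
  · filter_upwards [hbound] with t ht
    rw [subdiff_sq_add_abs_zero]
    exact abs_le.mp ht

end FracCH
end
end

section
/- Let β̂ : ℝ → [0,+∞] be convex, proper, lower semicontinuous with β̂(0) = 0, and let π̂ : ℝ → ℝ be C¹ with Lipschitz continuous derivative. Assume liminf_{|s|→+∞} (β̂(s)+π̂(s))/s² > 0. For λ > 0 let β̂_λ denote the Moreau–Yosida regularization of β̂ at level λ, defined by β̂_λ(s) := inf_{r∈ℝ} { (1/(2λ)) |r−s|² + β̂(r) }. Then there exist positive constants α, C, C' and λ₀ > 0 such that, for every λ ∈ (0,λ₀] and every s ∈ ℝ, β̂_λ(s) + π̂(s) ≥ α s² − C ≥ −C'. -/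
noncomputable section

open MeasureTheory Filter Topology Set ENNReal NNReal

namespace FracCH

/-- The Moreau--Yosida regularization of `b : ℝ → [0,+∞]` at level `lam > 0`:
`b_lam(s) = inf_t { (1/(2 lam)) |t - s|² + b(t) }`. -/
def moreauYosida (b : ℝ → ℝ≥0∞) (lam : ℝ) (s : ℝ) : ℝ≥0∞ :=
  ⨅ t : ℝ, (ENNReal.ofReal ((1 / (2 * lam)) * (t - s) ^ 2) + b t)

/-- A function whose derivative is `L`-Lipschitz grows at most quadratically around each point. -/
lemma le_add_of_lipschitz_deriv {f f' : ℝ → ℝ} {L : ℝ≥0} (hder : ∀ s, HasDerivAt f (f' s) s)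
    (hlip : LipschitzWith L f') (s t : ℝ) :
    f t ≤ f s + (|f' 0| + L * |s| + L * |t - s|) * |t - s| := by
  have hbound : ∀ x ∈ uIcc s t, ‖f' x‖ ≤ |f' 0| + L * |s| + L * |t - s| := by
    intro x hx
    have h₁ := hlip.dist_le_mul x s
    have h₂ := hlip.dist_le_mul s 0
    rw [Real.dist_eq, Real.dist_eq] at h₁ h₂
    rw [sub_zero] at h₂
    have h₃ : (L : ℝ) * |x - s| ≤ L * |t - s| :=
      mul_le_mul_of_nonneg_left (abs_sub_left_of_mem_uIcc hx) L.coe_nonneg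
    have h₄ : |f' x| ≤ |f' x - f' s| + |f' s - f' 0| + |f' 0| := by
      simpa using abs_add_three (f' x - f' s) (f' s - f' 0) (f' 0)
    rw [Real.norm_eq_abs]
    linarith
  have h := (convex_uIcc s t).norm_image_sub_le_of_norm_hasDerivWithin_le
    (fun x _ ↦ (hder x).hasDerivWithinAt) hbound left_mem_uIcc right_mem_uIcc
  rw [Real.norm_eq_abs, Real.norm_eq_abs] at h
  linarith [le_abs_self (f t - f s)]

/-- A quadratic lower bound valid near infinity holds everywhere up to an additive constant. -/
lemma exists_forall_ofReal_le_of_eventually {b : ℝ → ℝ≥0∞} {g : ℝ → ℝ} (hg : Continuous g)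
    (h : ∀ᶠ s : ℝ in Filter.comap (|·|) atTop, ENNReal.ofReal (g s) ≤ b s) :
    ∃ K : ℝ, 0 ≤ K ∧ ∀ t, ENNReal.ofReal (g t - K) ≤ b t := by
  rw [eventually_comap, eventually_atTop] at h
  obtain ⟨R, hR⟩ := h
  obtain ⟨K, hK⟩ := (isCompact_Icc (a := -R) (b := R)).bddAbove_image hg.continuousOn
  refine ⟨max K 0, le_max_right _ _, fun t ↦ ?_⟩
  rcases le_total R |t| with ht | ht
  · exact (ENNReal.ofReal_le_ofReal (by linarith [le_max_right K 0])).trans (hR _ ht t rfl)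
  · have : g t ≤ K := hK (mem_image_of_mem g (abs_le.mp ht))
    rw [ENNReal.ofReal_of_nonpos (by linarith [le_max_left K 0])]
    exact zero_le

/-- Quadratic terms in the increment `t - s` are absorbed by a large enough multiple of
`(t - s) ^ 2`. -/
lemma quadratic_lower_bound {α L P M s t : ℝ} (hα : 0 < α)
    (hM : α + L ^ 2 / α + 1 + L ≤ M) :
    α / 4 * s ^ 2 - P ^ 2 + (P + L * |s| + L * |t - s|) * |t - s|
      ≤ M * (t - s) ^ 2 + α * t ^ 2 := by
  have h₁ : L * |s| * |t - s| ≤ α / 4 * s ^ 2 + L ^ 2 / α * (t - s) ^ 2 := by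
    have h := sq_nonneg (α * |s| / 2 - L * |t - s|)
    have e : α / 4 * s ^ 2 + L ^ 2 / α * (t - s) ^ 2 - L * |s| * |t - s|
        = (α * |s| / 2 - L * |t - s|) ^ 2 / α := by
      rw [← sq_abs s, ← sq_abs (t - s)]
      field_simp
      ring
    linarith [div_nonneg h hα.le]
  have h₂ : P * |t - s| ≤ P ^ 2 + (t - s) ^ 2 := by
    rw [← sq_abs (t - s)]
    nlinarith [sq_nonneg (P - |t - s|), sq_nonneg P, sq_nonneg |t - s|]
  have h₃ : L * |t - s| * |t - s| = L * (t - s) ^ 2 := by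
    rw [← sq_abs (t - s)]
    ring
  have h₄ : α * (s ^ 2 / 2 - (t - s) ^ 2) ≤ α * t ^ 2 :=
    mul_le_mul_of_nonneg_left (by nlinarith [sq_nonneg (2 * t - s)]) hα.le
  linarith [mul_le_mul_of_nonneg_right hM (sq_nonneg (t - s))]

/-- **Inequality (3.1).** Let `β̂ : ℝ → [0,+∞]` be convex, l.s.c. with `β̂(0) = 0`, and
let `π̂` be `C¹` with Lipschitz continuous derivative; assume the coercivity
`liminf_{|s|→+∞} (β̂(s)+π̂(s))/s² > 0`.  Then there are positive constants
`α, C, C'` and a level `λ₀ > 0` such that for every `λ ∈ (0,λ₀]` and every `s ∈ ℝ`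
one has `β̂_λ(s) + π̂(s) ≥ α s² - C ≥ -C'`. -/
theorem moreau_yosida_coercivity
    (betah : ℝ → ℝ≥0∞) (pih piF : ℝ → ℝ) (Lpi : ℝ≥0)
    (hconv : ∀ a b t : ℝ, 0 ≤ t → t ≤ 1 →
      betah (t * a + (1 - t) * b)
        ≤ ENNReal.ofReal t * betah a + ENNReal.ofReal (1 - t) * betah b)
    (hlsc : LowerSemicontinuous betah) (hb0 : betah 0 = 0)
    (hder : ∀ s, HasDerivAt pih (piF s) s)
    (hlip : LipschitzWith Lpi piF)
    (hcoerc : ∃ α : ℝ, 0 < α ∧ ∀ᶠ s : ℝ in Filter.comap (|·|) atTop,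
      ENNReal.ofReal (α * s ^ 2 - pih s) ≤ betah s) :
    ∃ α C C' lam0 : ℝ, 0 < α ∧ 0 < C ∧ 0 < C' ∧ 0 < lam0 ∧
      ∀ lam : ℝ, 0 < lam → lam ≤ lam0 → ∀ s : ℝ,
        ENNReal.ofReal (α * s ^ 2 - C - pih s) ≤ moreauYosida betah lam s ∧
        -C' ≤ α * s ^ 2 - C := by
  obtain ⟨α, hα, hev⟩ := hcoerc
  have hcont : Continuous pih := continuous_iff_continuousAt.2 fun s ↦ (hder s).continuousAt
  obtain ⟨K, hK, hle⟩ := exists_forall_ofReal_le_of_eventually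
    (g := fun s ↦ α * s ^ 2 - pih s) (by fun_prop) hev
  set M : ℝ := α + (Lpi : ℝ) ^ 2 / α + 1 + Lpi
  have hM_pos : 0 < M := by positivity
  have hC : 0 < K + |piF 0| ^ 2 + 1 := by positivity
  refine ⟨α / 4, K + |piF 0| ^ 2 + 1, K + |piF 0| ^ 2 + 1, 1 / (2 * M), by positivity, hC, hC,
    by positivity, fun lam hlam hlam_le s ↦ ⟨le_iInf fun t ↦ ?_, ?_⟩⟩
  · have hM_le : M ≤ 1 / (2 * lam) := by
      rw [le_div_iff₀ (by positivity)] at hlam_le ⊢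
      linarith
    have h₁ := quadratic_lower_bound (P := |piF 0|) (s := s) (t := t) hα hM_le
    have h₂ := le_add_of_lipschitz_deriv hder hlip s t
    calc ENNReal.ofReal (α / 4 * s ^ 2 - (K + |piF 0| ^ 2 + 1) - pih s)
        ≤ ENNReal.ofReal (1 / (2 * lam) * (t - s) ^ 2 + (α * t ^ 2 - pih t - K)) :=
          ENNReal.ofReal_le_ofReal (by linarith)
      _ ≤ ENNReal.ofReal (1 / (2 * lam) * (t - s) ^ 2)
          + ENNReal.ofReal (α * t ^ 2 - pih t - K) := ENNReal.ofReal_add_le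
      _ ≤ ENNReal.ofReal (1 / (2 * lam) * (t - s) ^ 2) + betah t := by
          gcongr
          exact hle t
  · have : 0 ≤ α / 4 * s ^ 2 := by positivity
    linarith

end FracCH
end
end
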